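/- arXiv:2112.05605 — 11 statements merged into one kernel-verified Lean document; each statement's English description precedes it below -/
import Mathlib

section
/- Let P be a bounded linear operator on L²(μ) mapping L²₀(μ) into itself, let Φ satisfy the stated conditions with constant a, and suppose that for all f ∈ L²₀(μ) and all s > 0 one has the super-Poincaré inequality ‖f‖₂² ≤ s·(‖f‖₂² − ‖Pf‖₂²) + β(s)·Φ(f), where β : (0,∞) → [0,∞) is decreasing with β(s) → 0 as s → ∞. Then for every f ∈ L²₀(μ) with 0 < Φ(f) < ∞ and every n ∈ ℕ, ‖Pⁿf‖₂² ≤ Φ(f)·F_a⁻¹(n). -/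
open MeasureTheory Filter
open scoped ENNReal

/-- `K(u) := u·β(1/u)` for `u ≠ 0`, with `K(0) := 0`. -/
noncomputable def Kfun (β : ℝ → ℝ) (u : ℝ) : ℝ := if u = 0 then 0 else u * β u⁻¹

/-- The convex conjugate `K*(v) := sup_{u ≥ 0} (u·v − K(u))`, valued in `[0,∞]`. -/
noncomputable def Kstar (β : ℝ → ℝ) (v : ℝ) : ℝ≥0∞ :=
  ⨆ u ∈ Set.Ici (0 : ℝ), ENNReal.ofReal (u * v - Kfun β u)

/-- `F_a(x) := ∫_x^a dv / K*(v)`. -/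
noncomputable def Fa (β : ℝ → ℝ) (a x : ℝ) : ℝ :=
  (∫⁻ v in Set.Ioc x a, (Kstar β v)⁻¹).toReal

theorem Kstar_mono (β : ℝ → ℝ) : Monotone (Kstar β) := by
  intro v w hvw
  refine iSup₂_mono fun u hu => ENNReal.ofReal_le_ofReal ?_
  have : u * v ≤ u * w := mul_le_mul_of_nonneg_left hvw hu
  linarith

theorem Kstar_ne_zero {β : ℝ → ℝ} (hβ : Tendsto β atTop (nhds 0)) {v : ℝ} (hv : 0 < v) :
    Kstar β v ≠ 0 := by
  obtain ⟨s, hs, hs0⟩ := ((hβ.eventually (gt_mem_nhds hv)).and (eventually_gt_atTop 0)).exists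
  have hle : ENNReal.ofReal (s⁻¹ * v - Kfun β s⁻¹) ≤ Kstar β v :=
    le_iSup₂ (f := fun u (_ : u ∈ Set.Ici (0 : ℝ)) => ENNReal.ofReal (u * v - Kfun β u))
      s⁻¹ (inv_pos.2 hs0).le
  have hpos : 0 < s⁻¹ * v - Kfun β s⁻¹ := by
    rw [Kfun, if_neg (inv_pos.2 hs0).ne', inv_inv, ← mul_sub]
    exact mul_pos (inv_pos.2 hs0) (sub_pos.2 hs)
  exact ((ENNReal.ofReal_pos.2 hpos).trans_le hle).ne'

/-- A super-Poincaré type family of inequalities bounds `K*(v)` by the decrement `v - w`. -/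
theorem le_and_Kstar_le_of_forall_le {β : ℝ → ℝ} (hβ : Tendsto β atTop (nhds 0)) {v w : ℝ}
    (h : ∀ s : ℝ, 0 < s → v ≤ s * (v - w) + β s) :
    w ≤ v ∧ Kstar β v ≤ ENNReal.ofReal (v - w) := by
  have hwv : w ≤ v := by
    have hlim : Tendsto (fun s : ℝ => s⁻¹ * (v - β s)) atTop (nhds (0 * (v - 0))) :=
      tendsto_inv_atTop_zero.mul (tendsto_const_nhds.sub hβ)
    rw [zero_mul] at hlim
    refine sub_nonneg.1 (le_of_tendsto hlim ?_)
    filter_upwards [eventually_gt_atTop 0] with s hs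
    rw [inv_mul_le_iff₀ hs]
    linarith [h s hs]
  refine ⟨hwv, iSup₂_le fun u hu => ENNReal.ofReal_le_ofReal ?_⟩
  rcases (show (0 : ℝ) ≤ u from hu).eq_or_lt with rfl | hu
  · simpa [Kfun] using hwv
  · rw [Kfun, if_neg hu.ne', ← mul_sub, ← le_inv_mul_iff₀ hu]
    linarith [h u⁻¹ (inv_pos.2 hu)]

/-- The integral of `1 / K*` over `(w, v]` is at least `(v - w) / K*(v)`. -/
theorem le_lintegral_inv_Kstar (β : ℝ → ℝ) (w v : ℝ) :
    (Kstar β v)⁻¹ * ENNReal.ofReal (v - w) ≤ ∫⁻ t in Set.Ioc w v, (Kstar β t)⁻¹ := by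
  rw [← Real.volume_Ioc, ← setLIntegral_const]
  exact setLIntegral_mono' measurableSet_Ioc fun t ht =>
    ENNReal.inv_le_inv.2 (Kstar_mono β ht.2)

theorem lintegral_inv_Kstar_ne_top {β : ℝ → ℝ} (hβ : Tendsto β atTop (nhds 0)) {w : ℝ}
    (hw : 0 < w) (v : ℝ) : ∫⁻ t in Set.Ioc w v, (Kstar β t)⁻¹ ≠ ∞ := by
  refine ne_top_of_le_ne_top (b := (Kstar β w)⁻¹ * volume (Set.Ioc w v)) ?_ ?_
  · exact ENNReal.mul_ne_top (ENNReal.inv_ne_top.2 (Kstar_ne_zero hβ hw)) measure_Ioc_lt_top.ne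
  · rw [← setLIntegral_const]
    exact setLIntegral_mono' measurableSet_Ioc fun t ht =>
      ENNReal.inv_le_inv.2 (Kstar_mono β ht.1.le)

theorem lintegral_Ioc_add (g : ℝ → ℝ≥0∞) {x y z : ℝ} (hxy : x ≤ y) (hyz : y ≤ z) :
    ∫⁻ t in Set.Ioc x z, g t = (∫⁻ t in Set.Ioc x y, g t) + ∫⁻ t in Set.Ioc y z, g t := by
  rw [← Set.Ioc_union_Ioc_eq_Ioc hxy hyz,
    lintegral_union measurableSet_Ioc (Set.Ioc_disjoint_Ioc_of_le le_rfl)]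

/-- If each decrement of `v` dominates `K*`, then `n` steps use up at least `n` units of the
integral of `1 / K*`. -/
theorem natCast_le_lintegral_inv_Kstar {β : ℝ → ℝ} (hβ : Tendsto β atTop (nhds 0)) {v : ℕ → ℝ}
    (hv : Antitone v) (hK : ∀ k, Kstar β (v k) ≤ ENNReal.ofReal (v k - v (k + 1))) (n : ℕ)
    (hn : 0 < v n) : (n : ℝ≥0∞) ≤ ∫⁻ t in Set.Ioc (v n) (v 0), (Kstar β t)⁻¹ := by
  induction n with
  | zero => simp
  | succ n ih =>
    have hpos : 0 < v n := hn.trans_le (hv n.le_succ)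
    have hstep : 1 ≤ ∫⁻ t in Set.Ioc (v (n + 1)) (v n), (Kstar β t)⁻¹ := by
      refine le_trans ?_ (le_lintegral_inv_Kstar β _ _)
      rw [← ENNReal.inv_mul_cancel (Kstar_ne_zero hβ hpos)
        (ne_top_of_le_ne_top ENNReal.ofReal_ne_top (hK n))]
      gcongr
      exact hK n
    rw [lintegral_Ioc_add _ (hv n.le_succ) (hv n.zero_le), Nat.cast_succ, add_comm]
    exact add_le_add hstep (ih hpos)

/-- Theorem (convergence from a super-Poincaré inequality): if `P*P` satisfies a
super-Poincaré inequality, then `‖Pⁿf‖₂² ≤ Φ(f)·F_a⁻¹(n)` for all `f ∈ L²₀(μ)` with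
`0 < Φ(f) < ∞`. -/
theorem stmt0 {E : Type*} [MeasurableSpace E] (μ : Measure E) [IsProbabilityMeasure μ]
    (P : Lp ℝ 2 μ →L[ℝ] Lp ℝ 2 μ)
    (L20 : Set (Lp ℝ 2 μ)) (hL20 : L20 = {f : Lp ℝ 2 μ | ∫ x, f x ∂μ = 0})
    (hP0 : ∀ f ∈ L20, P f ∈ L20)
    (Φ : Lp ℝ 2 μ → ℝ≥0∞)
    (hΦhom : ∀ c : ℝ, 0 < c → ∀ f : Lp ℝ 2 μ, Φ (c • f) = ENNReal.ofReal (c ^ 2) * Φ f)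
    (hΦP : ∀ (n : ℕ) (f : Lp ℝ 2 μ), Φ ((P ^ n) f) ≤ Φ f)
    (a : ℝ) (ha : 0 < a)
    (hdom : ∀ f ∈ L20, Φ f ≠ ∞ → ‖f‖ ^ 2 ≤ a * (Φ f).toReal)
    (hleast : ∀ a' : ℝ, (∀ f ∈ L20, Φ f ≠ ∞ → ‖f‖ ^ 2 ≤ a' * (Φ f).toReal) → a ≤ a')
    (β : ℝ → ℝ) (hβ0 : ∀ s : ℝ, 0 < s → 0 ≤ β s)
    (hβdec : AntitoneOn β (Set.Ioi 0))
    (hβlim : Tendsto β atTop (nhds 0))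
    (hSPI : ∀ f ∈ L20, Φ f ≠ ∞ → ∀ s : ℝ, 0 < s →
      ‖f‖ ^ 2 ≤ s * (‖f‖ ^ 2 - ‖P f‖ ^ 2) + β s * (Φ f).toReal)
    (Finv : ℝ → ℝ)
    (hFinv : ∀ x : ℝ, 0 < x → Finv x ∈ Set.Ioo 0 a ∧ Fa β a (Finv x) = x) :
    ∀ f ∈ L20, Φ f ≠ 0 → Φ f ≠ ∞ → ∀ n : ℕ, 1 ≤ n →
      ‖(P ^ n) f‖ ^ 2 ≤ (Φ f).toReal * Finv (n : ℝ) := by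
  subst hL20
  intro f hf hΦ0 hΦtop n hn
  set c := (Φ f).toReal with hc_def
  have hc : 0 < c := ENNReal.toReal_pos hΦ0 hΦtop
  set v : ℕ → ℝ := fun k => ‖(P ^ k) f‖ ^ 2 / c with hv_def
  have hmem : ∀ k, (P ^ k) f ∈ {f : Lp ℝ 2 μ | ∫ x, f x ∂μ = 0} := by
    intro k
    induction k with
    | zero => simpa using hf
    | succ k ih => rw [pow_succ']; exact hP0 _ ih
  have hdecr : ∀ k, v (k + 1) ≤ v k ∧ Kstar β (v k) ≤ ENNReal.ofReal (v k - v (k + 1)) := by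
    intro k
    refine le_and_Kstar_le_of_forall_le hβlim fun s hs => ?_
    have hspi := hSPI _ (hmem k) (ne_top_of_le_ne_top hΦtop (hΦP k f)) s hs
    have hle : β s * (Φ ((P ^ k) f)).toReal ≤ β s * c :=
      mul_le_mul_of_nonneg_left (ENNReal.toReal_mono hΦtop (hΦP k f)) (hβ0 s hs)
    have hP : (P ^ (k + 1)) f = P ((P ^ k) f) := by rw [pow_succ']; rfl
    simp only [hv_def, hP]
    rw [div_le_iff₀ hc, add_mul, mul_assoc, sub_mul, div_mul_cancel₀ _ hc.ne',
      div_mul_cancel₀ _ hc.ne']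
    linarith
  have hanti : Antitone v := antitone_nat_of_succ_le fun k => (hdecr k).1
  have hv0 : v 0 ≤ a := by
    simpa [hv_def] using (div_le_iff₀ hc).2 (hdom f hf hΦtop)
  obtain ⟨⟨hy0, -⟩, hFy⟩ := hFinv n (by exact_mod_cast hn)
  rw [mul_comm, ← div_le_iff₀ hc]
  change v n ≤ _
  by_contra! hlt
  set y := Finv n
  have hn_le := natCast_le_lintegral_inv_Kstar hβlim hanti (fun k => (hdecr k).2) n (hy0.trans hlt)
  have hKtop : Kstar β (v n) ≠ ∞ :=
    ne_top_of_le_ne_top ENNReal.ofReal_ne_top (hdecr n).2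
  have hgap : 0 < ∫⁻ t in Set.Ioc y (v n), (Kstar β t)⁻¹ :=
    (ENNReal.mul_pos (ENNReal.inv_ne_zero.2 hKtop)
      (ENNReal.ofReal_pos.2 (sub_pos.2 hlt)).ne').trans_le (le_lintegral_inv_Kstar β _ _)
  have hint : ∫⁻ t in Set.Ioc y a, (Kstar β t)⁻¹ = n := by
    rw [← ENNReal.ofReal_toReal (lintegral_inv_Kstar_ne_top hβlim hy0 a)]
    exact (congrArg ENNReal.ofReal hFy).trans (ENNReal.ofReal_natCast n)
  rw [lintegral_Ioc_add _ hlt.le ((hanti n.zero_le).trans hv0),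
    lintegral_Ioc_add _ (hanti n.zero_le) hv0] at hint
  have hcontra : (n : ℝ≥0∞) < n := by
    calc (n : ℝ≥0∞)
        < (∫⁻ t in Set.Ioc y (v n), (Kstar β t)⁻¹) + n := by
          rw [add_comm]
          exact ENNReal.lt_add_right (ENNReal.natCast_ne_top n) hgap.ne'
      _ ≤ n := by
          conv_rhs => rw [← hint]
          gcongr
          exact hn_le.trans le_self_add
  exact hcontra.false
end

section
/- Let a > 0 and let β : (0,∞) → [0,∞) be decreasing with β(s) → 0 as s → ∞ and β(s) ≥ a·(1−s) for all s ∈ (0,1). Then the function F_a(x) := ∫_x^a dv/K*(v), defined on (0,a], (1) is well-defined, convex, continuous and strictly decreasing; (2) satisfies F_a(x) → ∞ as x ↓ 0; and (3) has a well-defined inverse function F_a⁻¹ : (0,∞) → (0,a) satisfying F_a⁻¹(x) → 0 as x → ∞. -/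
open MeasureTheory Filter
open scoped ENNReal

theorem Kstar_le {a : ℝ} {β : ℝ → ℝ} (hβ0 : ∀ s : ℝ, 0 < s → 0 ≤ β s)
    (hβa : ∀ s ∈ Set.Ioo (0 : ℝ) 1, a * (1 - s) ≤ β s) {v : ℝ} (hv : 0 < v) (hva : v ≤ a) :
    Kstar β v ≤ ENNReal.ofReal v := by
  refine iSup₂_le fun u hu => ENNReal.ofReal_le_ofReal ?_
  rw [Kfun]
  split_ifs with h
  · subst h
    linarith
  have hu0 : 0 < u := lt_of_le_of_ne hu (Ne.symm h)
  rcases le_or_gt u 1 with h1 | h1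
  · have := mul_nonneg hu0.le (hβ0 u⁻¹ (inv_pos.mpr hu0))
    nlinarith
  · have hb := mul_le_mul_of_nonneg_left
      (hβa u⁻¹ ⟨inv_pos.mpr hu0, inv_lt_one_of_one_lt₀ h1⟩) hu0.le
    have he : u * (a * (1 - u⁻¹)) = a * u - a := by field_simp
    nlinarith

theorem Kstar_pos {β : ℝ → ℝ} (hβlim : Tendsto β atTop (nhds 0)) {v : ℝ} (hv : 0 < v) :
    0 < Kstar β v := by
  obtain ⟨s, hs, hs0⟩ := ((hβlim.eventually_lt_const hv).and (eventually_gt_atTop 0)).exists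
  have hu : 0 < s⁻¹ := inv_pos.mpr hs0
  refine lt_of_lt_of_le ?_ (le_iSup₂ (f := fun u (_ : u ∈ Set.Ici (0 : ℝ)) =>
    ENNReal.ofReal (u * v - Kfun β u)) s⁻¹ hu.le)
  rw [ENNReal.ofReal_pos, Kfun, if_neg hu.ne', inv_inv, ← mul_sub]
  exact mul_pos hu (sub_pos.mpr hs)

/-- The tail integral of an antitone function is finite wherever the function is. -/
theorem setLIntegral_Ioc_ne_top {h : ℝ → ℝ≥0∞} (hh : Antitone h) {x : ℝ} (a : ℝ) (hx : h x ≠ ∞) :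
    (∫⁻ v in Set.Ioc x a, h v) ≠ ∞ := by
  refine ne_top_of_le_ne_top (ENNReal.mul_ne_top hx ?_)
    ((setLIntegral_mono' measurableSet_Ioc fun v hv => hh hv.1.le).trans_eq
      (setLIntegral_const _ _))
  simp

/-- Increments of the tail integral of an antitone function lie between the rectangles given by
the endpoint values. -/
theorem toReal_setLIntegral_Ioc_sub_mem_Icc {h : ℝ → ℝ≥0∞} (hh : Antitone h) {a x y : ℝ}
    (hx : h x ≠ ∞) (hxy : x ≤ y) (hya : y ≤ a) :
    (∫⁻ v in Set.Ioc x a, h v).toReal - (∫⁻ v in Set.Ioc y a, h v).toReal ∈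
      Set.Icc ((h y).toReal * (y - x)) ((h x).toReal * (y - x)) := by
  have hy : h y ≠ ∞ := ne_top_of_le_ne_top hx (hh hxy)
  have hfin := setLIntegral_Ioc_ne_top hh y hx
  have hsplit : (∫⁻ v in Set.Ioc x a, h v) =
      (∫⁻ v in Set.Ioc x y, h v) + ∫⁻ v in Set.Ioc y a, h v := by
    rw [← Set.Ioc_union_Ioc_eq_Ioc hxy hya,
      lintegral_union measurableSet_Ioc (Set.Ioc_disjoint_Ioc_of_le le_rfl)]
  have hconst (c : ℝ≥0∞) : (∫⁻ _ in Set.Ioc x y, c).toReal = c.toReal * (y - x) := by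
    rw [setLIntegral_const, Real.volume_Ioc, ENNReal.toReal_mul,
      ENNReal.toReal_ofReal (sub_nonneg.mpr hxy)]
  rw [hsplit, ENNReal.toReal_add hfin (setLIntegral_Ioc_ne_top hh a hy), add_sub_cancel_right,
    ← hconst, ← hconst]
  refine ⟨ENNReal.toReal_mono hfin (setLIntegral_mono' measurableSet_Ioc fun v hv => hh hv.2),
    ENNReal.toReal_mono ?_ (setLIntegral_mono' measurableSet_Ioc fun v hv => hh hv.1.le)⟩
  rw [setLIntegral_const]
  exact ENNReal.mul_ne_top hx (by simp)

section Increments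

variable {F g : ℝ → ℝ} {a : ℝ}

theorem convexOn_of_sub_mem_Icc
    (hF : ∀ x y, 0 < x → x ≤ y → y ≤ a →
      F x - F y ∈ Set.Icc (g y * (y - x)) (g x * (y - x))) :
    ConvexOn ℝ (Set.Ioc 0 a) F := by
  refine convexOn_of_slope_mono_adjacent (convex_Ioc 0 a) fun {x y z} hx hz hxy hyz => ?_
  have h1 := (hF x y hx.1 hxy.le (hyz.le.trans hz.2)).1
  have h2 := (hF y z (hx.1.trans hxy) hyz.le hz.2).2
  calc (F y - F x) / (y - x) ≤ -g y := by
        rw [div_le_iff₀ (sub_pos.mpr hxy)]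
        linarith
    _ ≤ (F z - F y) / (z - y) := by
        rw [le_div_iff₀ (sub_pos.mpr hyz)]
        linarith

theorem strictAntiOn_of_sub_mem_Icc (hg : ∀ v ∈ Set.Ioc 0 a, 0 < g v)
    (hF : ∀ x y, 0 < x → x ≤ y → y ≤ a →
      F x - F y ∈ Set.Icc (g y * (y - x)) (g x * (y - x))) :
    StrictAntiOn F (Set.Ioc 0 a) := by
  intro x hx y hy hxy
  have h1 := (hF x y hx.1 hxy.le hy.2).1
  have h2 := mul_pos (hg y hy) (sub_pos.mpr hxy)
  linarith

theorem continuousOn_of_sub_mem_Icc (hg0 : ∀ v ∈ Set.Ioc 0 a, 0 < g v)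
    (hg : AntitoneOn g (Set.Ioc 0 a))
    (hF : ∀ x y, 0 < x → x ≤ y → y ≤ a →
      F x - F y ∈ Set.Icc (g y * (y - x)) (g x * (y - x))) :
    ContinuousOn F (Set.Ioc 0 a) := by
  intro x hx
  have hc : x / 2 ∈ Set.Ioc 0 a := ⟨by linarith [hx.1], by linarith [hx.1, hx.2]⟩
  have hanti := (strictAntiOn_of_sub_mem_Icc hg0 hF).antitoneOn
  have hlip : LipschitzOnWith (g (x / 2)).toNNReal F (Set.Icc (x / 2) a) := by
    refine LipschitzOnWith.of_le_add_mul _ fun y hy z hz => ?_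
    rw [Real.coe_toNNReal _ (hg0 _ hc).le, Real.dist_eq]
    have hy' : y ∈ Set.Ioc 0 a := ⟨hc.1.trans_le hy.1, hy.2⟩
    have hz' : z ∈ Set.Ioc 0 a := ⟨hc.1.trans_le hz.1, hz.2⟩
    rcases le_total y z with hyz | hyz
    · have h1 := (hF y z hy'.1 hyz hz.2).2
      have h2 := mul_le_mul_of_nonneg_right (hg hc hy' hy.1) (sub_nonneg.mpr hyz)
      rw [abs_sub_comm, abs_of_nonneg (sub_nonneg.mpr hyz)]
      linarith
    · have h1 := hanti hz' hy' hyz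
      have h2 := mul_nonneg (hg0 _ hc).le (abs_nonneg (y - z))
      linarith
  refine (hlip.continuousOn x ⟨by linarith [hx.1], hx.2⟩).mono_of_mem_nhdsWithin ?_
  filter_upwards [self_mem_nhdsWithin,
    mem_nhdsWithin_of_mem_nhds (lt_mem_nhds (half_lt_self hx.1))] with y hy1 hy2
  exact ⟨hy2.le, hy1.2⟩

theorem tendsto_atTop_of_sub_mem_Icc (ha : 0 < a) (hg : ∀ v ∈ Set.Ioc 0 a, v⁻¹ ≤ g v)
    (hF : ∀ x y, 0 < x → x ≤ y → y ≤ a →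
      F x - F y ∈ Set.Icc (g y * (y - x)) (g x * (y - x))) :
    Tendsto F (nhdsWithin 0 (Set.Ioi 0)) atTop := by
  have hanti := (strictAntiOn_of_sub_mem_Icc
    (fun v hv => (inv_pos.mpr hv.1).trans_le (hg v hv)) hF).antitoneOn
  have hmem (n : ℕ) : a / 2 ^ n ∈ Set.Ioc 0 a :=
    ⟨by positivity, div_le_self ha.le (one_le_pow₀ one_le_two)⟩
  have hstep (n : ℕ) : F a + n / 2 ≤ F (a / 2 ^ n) := by
    induction n with
    | zero => simp
    | succ n ih =>
      have hhalf : a / 2 ^ (n + 1) = a / 2 ^ n / 2 := by rw [pow_succ, div_div]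
      rw [hhalf]
      have hy := hmem n
      generalize a / 2 ^ n = y at hy ih
      have h1 := (hF (y / 2) y (half_pos hy.1) (half_le_self hy.1.le) hy.2).1
      have h2 := mul_le_mul_of_nonneg_right (hg y hy) (half_pos hy.1).le
      have h3 : y⁻¹ * (y / 2) = 1 / 2 := by
        have := hy.1.ne'
        field_simp
      push_cast
      rw [sub_half] at h1
      linarith
  refine tendsto_atTop.mpr fun M => ?_
  obtain ⟨n, hn⟩ := exists_nat_ge (2 * (M - F a))
  filter_upwards [Ioc_mem_nhdsGT (hmem n).1] with x hx
  have := hanti ⟨hx.1, hx.2.trans (hmem n).2⟩ (hmem n) hx.2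
  linarith [hstep n]

end Increments

/-- A continuous strictly decreasing function on `(0,a]` that vanishes at `a` and blows up at `0`
has an inverse `(0,∞) → (0,a)`, and this inverse tends to `0` at `∞`. -/
theorem exists_inverse_tendsto_zero {F : ℝ → ℝ} {a : ℝ} (ha : 0 < a) (hFa : F a = 0)
    (hcont : ContinuousOn F (Set.Ioc 0 a)) (hanti : StrictAntiOn F (Set.Ioc 0 a))
    (hlim : Tendsto F (nhdsWithin 0 (Set.Ioi 0)) atTop) :
    ∃ Finv : ℝ → ℝ, (∀ x : ℝ, 0 < x → Finv x ∈ Set.Ioo 0 a ∧ F (Finv x) = x) ∧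
      Tendsto Finv atTop (nhds 0) := by
  have hsurj (x : ℝ) (hx : 0 < x) : ∃ y ∈ Set.Ioo 0 a, F y = x := by
    obtain ⟨c, hc, hca⟩ := ((hlim.eventually_gt_atTop x).and (Ioo_mem_nhdsGT ha)).exists
    obtain ⟨y, hy, rfl⟩ := intermediate_value_Ioo' hca.2.le
      (hcont.mono fun z hz => ⟨hca.1.trans_le hz.1, hz.2⟩) ⟨hFa.trans_lt hx, hc⟩
    exact ⟨y, ⟨hca.1.trans hy.1, hy.2⟩, rfl⟩
  choose! Finv hmem hinv using hsurj
  refine ⟨Finv, fun x hx => ⟨hmem x hx, hinv x hx⟩, tendsto_order.mpr ⟨fun b hb => ?_, fun b hb => ?_⟩⟩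
  · filter_upwards [eventually_gt_atTop 0] with x hx using hb.trans (hmem x hx).1
  · have hc : min b a ∈ Set.Ioc 0 a := ⟨lt_min hb ha, min_le_right _ _⟩
    filter_upwards [eventually_gt_atTop 0, eventually_gt_atTop (F (min b a))] with x hx hxF
    have hy := hmem x hx
    rw [← hinv x hx] at hxF
    exact ((hanti.lt_iff_gt hc ⟨hy.1, hy.2.le⟩).mp hxF).trans_le (min_le_left _ _)

/-- Lemma (properties of F_a): F_a is well-defined, convex, continuous, strictly decreasing,
tends to ∞ at 0, and has a well-defined inverse tending to 0 at ∞. -/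
theorem stmt1 (a : ℝ) (ha : 0 < a) (β : ℝ → ℝ)
    (hβ0 : ∀ s : ℝ, 0 < s → 0 ≤ β s)
    (hβdec : AntitoneOn β (Set.Ioi 0))
    (hβlim : Tendsto β atTop (nhds 0))
    (hβa : ∀ s ∈ Set.Ioo (0 : ℝ) 1, a * (1 - s) ≤ β s) :
    (∀ x ∈ Set.Ioc (0 : ℝ) a, (∫⁻ v in Set.Ioc x a, (Kstar β v)⁻¹) ≠ ∞) ∧
    ConvexOn ℝ (Set.Ioc 0 a) (Fa β a) ∧
    ContinuousOn (Fa β a) (Set.Ioc 0 a) ∧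
    StrictAntiOn (Fa β a) (Set.Ioc 0 a) ∧
    Tendsto (Fa β a) (nhdsWithin 0 (Set.Ioi 0)) atTop ∧
    ∃ Finv : ℝ → ℝ,
      (∀ x : ℝ, 0 < x → Finv x ∈ Set.Ioo 0 a ∧ Fa β a (Finv x) = x) ∧
      Tendsto Finv atTop (nhds 0) := by
  have hh : Antitone fun v => (Kstar β v)⁻¹ := fun v w hvw =>
    ENNReal.inv_le_inv.mpr (Kstar_mono β hvw)
  have hfin (v : ℝ) (hv : 0 < v) : (Kstar β v)⁻¹ ≠ ∞ :=
    ENNReal.inv_ne_top.mpr (Kstar_pos hβlim hv).ne'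
  have hF : ∀ x y, 0 < x → x ≤ y → y ≤ a → Fa β a x - Fa β a y ∈
      Set.Icc ((Kstar β y)⁻¹.toReal * (y - x)) ((Kstar β x)⁻¹.toReal * (y - x)) :=
    fun x y hx hxy hya => toReal_setLIntegral_Ioc_sub_mem_Icc hh (hfin x hx) hxy hya
  have hg : ∀ v ∈ Set.Ioc 0 a, v⁻¹ ≤ (Kstar β v)⁻¹.toReal := by
    intro v hv
    have h := ENNReal.toReal_mono (hfin v hv.1)
      (ENNReal.inv_le_inv.mpr (Kstar_le hβ0 hβa hv.1 hv.2))
    rwa [ENNReal.toReal_inv, ENNReal.toReal_ofReal hv.1.le] at h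
  have hg0 : ∀ v ∈ Set.Ioc 0 a, 0 < (Kstar β v)⁻¹.toReal := fun v hv =>
    (inv_pos.mpr hv.1).trans_le (hg v hv)
  have hganti : AntitoneOn (fun v => (Kstar β v)⁻¹.toReal) (Set.Ioc 0 a) :=
    fun v hv w _ hvw => ENNReal.toReal_mono (hfin v hv.1) (hh hvw)
  have hcont := continuousOn_of_sub_mem_Icc hg0 hganti hF
  have hanti := strictAntiOn_of_sub_mem_Icc hg0 hF
  have hlim := tendsto_atTop_of_sub_mem_Icc ha hg hF
  exact ⟨fun x hx => setLIntegral_Ioc_ne_top hh a (hfin x hx.1), convexOn_of_sub_mem_Icc hF,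
    hcont, hanti, hlim, exists_inverse_tendsto_zero ha (by simp [Fa]) hcont hanti hlim⟩
end

section
/- Let a > 0 and let β : (0,∞) → [0,∞) be decreasing with β(s) → 0 as s → ∞. Then: (i) K*(0) = 0 and K*(v) > 0 for every v > 0; (ii) K* is convex; (iii) the map v ↦ K*(v)/v is increasing on (0,∞); (iv) if in addition β(s) ≥ a·(1−s) for all s ∈ (0,1), then K*(v) ≤ v for all v ∈ [0,a], and for every v ∈ [0,a) the quantity K⁻(v) := sup{u ≥ 0 : K(u) ≤ u·v} is finite and K*(v) = sup_{0 ≤ u ≤ K⁻(v)} (u·v − K(u)). -/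
open MeasureTheory Filter
open scoped ENNReal

/-- `K⁻(v) := sup {u ≥ 0 : K(u) ≤ u·v}`. -/
noncomputable def Kminus (β : ℝ → ℝ) (v : ℝ) : ℝ :=
  sSup {u : ℝ | 0 ≤ u ∧ Kfun β u ≤ u * v}

theorem Kfun_nonneg {β : ℝ → ℝ} (hβ0 : ∀ s : ℝ, 0 < s → 0 ≤ β s) {u : ℝ} (hu : 0 ≤ u) :
    0 ≤ Kfun β u := by
  unfold Kfun
  split_ifs with h
  · exact le_rfl
  · exact mul_nonneg hu (hβ0 _ (inv_pos.mpr (lt_of_le_of_ne hu (Ne.symm h))))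

theorem ofReal_le_Kstar (β : ℝ → ℝ) (v : ℝ) {u : ℝ} (hu : 0 ≤ u) :
    ENNReal.ofReal (u * v - Kfun β u) ≤ Kstar β v :=
  le_iSup₂_of_le (f := fun u (_ : u ∈ Set.Ici (0 : ℝ)) => ENNReal.ofReal (u * v - Kfun β u))
    u hu le_rfl

theorem Kstar_zero {β : ℝ → ℝ} (hβ0 : ∀ s : ℝ, 0 < s → 0 ≤ β s) : Kstar β 0 = 0 := by
  refine le_antisymm (iSup₂_le fun u hu => ?_) zero_le
  rw [ENNReal.ofReal_of_nonpos]
  linarith [Kfun_nonneg hβ0 hu]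

theorem Kstar_convex (β : ℝ → ℝ) (v₁ v₂ : ℝ) {t : ℝ} (ht0 : 0 ≤ t) (ht1 : t ≤ 1) :
    Kstar β (t * v₁ + (1 - t) * v₂) ≤
      ENNReal.ofReal t * Kstar β v₁ + ENNReal.ofReal (1 - t) * Kstar β v₂ := by
  refine iSup₂_le fun u hu => ?_
  have h : u * (t * v₁ + (1 - t) * v₂) - Kfun β u =
      t * (u * v₁ - Kfun β u) + (1 - t) * (u * v₂ - Kfun β u) := by ring
  rw [h]
  refine ENNReal.ofReal_add_le.trans ?_
  rw [ENNReal.ofReal_mul ht0, ENNReal.ofReal_mul (sub_nonneg.mpr ht1)]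
  gcongr <;> exact ofReal_le_Kstar β _ hu

theorem Kstar_div_mono {β : ℝ → ℝ} (hβ0 : ∀ s : ℝ, 0 < s → 0 ≤ β s) {v₁ v₂ : ℝ}
    (hv₁ : 0 < v₁) (hv : v₁ ≤ v₂) :
    Kstar β v₁ / ENNReal.ofReal v₁ ≤ Kstar β v₂ / ENNReal.ofReal v₂ := by
  have hv₂ := hv₁.trans_le hv
  rw [ENNReal.div_le_iff (ENNReal.ofReal_pos.mpr hv₁).ne' ENNReal.ofReal_ne_top]
  refine iSup₂_le fun u hu => ?_
  rw [← ENNReal.div_le_iff (ENNReal.ofReal_pos.mpr hv₁).ne' ENNReal.ofReal_ne_top]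
  refine le_trans ?_ (ENNReal.div_le_div_right (ofReal_le_Kstar β v₂ hu) _)
  rw [← ENNReal.ofReal_div_of_pos hv₁, ← ENNReal.ofReal_div_of_pos hv₂]
  refine ENNReal.ofReal_le_ofReal ?_
  rw [div_le_div_iff₀ hv₁ hv₂]
  nlinarith [mul_le_mul_of_nonneg_left hv (Kfun_nonneg hβ0 hu)]

theorem le_Kfun_of_one_lt {a : ℝ} {β : ℝ → ℝ}
    (hβ : ∀ s ∈ Set.Ioo (0 : ℝ) 1, a * (1 - s) ≤ β s) {u : ℝ} (hu : 1 < u) :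
    a * (u - 1) ≤ Kfun β u := by
  have hu0 : 0 < u := one_pos.trans hu
  rw [Kfun, if_neg hu0.ne']
  calc a * (u - 1) = u * (a * (1 - u⁻¹)) := by field_simp
    _ ≤ u * β u⁻¹ :=
      mul_le_mul_of_nonneg_left (hβ _ ⟨inv_pos.mpr hu0, inv_lt_one_of_one_lt₀ hu⟩) hu0.le

theorem Kstar_le_ofReal {a : ℝ} {β : ℝ → ℝ} (hβ0 : ∀ s : ℝ, 0 < s → 0 ≤ β s)
    (hβ : ∀ s ∈ Set.Ioo (0 : ℝ) 1, a * (1 - s) ≤ β s) {v : ℝ} (hv0 : 0 ≤ v) (hva : v ≤ a) :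
    Kstar β v ≤ ENNReal.ofReal v := by
  refine iSup₂_le fun u hu => ENNReal.ofReal_le_ofReal ?_
  rcases le_or_gt u 1 with h | h
  · nlinarith [Kfun_nonneg hβ0 hu, mul_le_mul_of_nonneg_right h hv0]
  · nlinarith [le_Kfun_of_one_lt hβ h, mul_nonneg (sub_nonneg.mpr h.le) (sub_nonneg.mpr hva)]

theorem bddAbove_Kfun_le_mul {a : ℝ} {β : ℝ → ℝ}
    (hβ : ∀ s ∈ Set.Ioo (0 : ℝ) 1, a * (1 - s) ≤ β s) {v : ℝ} (hva : v < a) :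
    BddAbove {u : ℝ | 0 ≤ u ∧ Kfun β u ≤ u * v} := by
  refine ⟨max 1 (a / (a - v)), ?_⟩
  rintro u ⟨-, hKu⟩
  rcases le_or_gt u 1 with h | h
  · exact le_max_of_le_left h
  · refine le_max_of_le_right ?_
    rw [le_div_iff₀ (sub_pos.mpr hva)]
    linarith [le_Kfun_of_one_lt hβ h]

theorem Kstar_eq_iSup_Icc_Kminus {β : ℝ → ℝ} {v : ℝ}
    (hbdd : BddAbove {u : ℝ | 0 ≤ u ∧ Kfun β u ≤ u * v}) :
    Kstar β v = ⨆ u ∈ Set.Icc (0 : ℝ) (Kminus β v), ENNReal.ofReal (u * v - Kfun β u) := by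
  refine le_antisymm (iSup₂_le fun u hu => ?_)
    (iSup₂_le fun u hu => ofReal_le_Kstar β v hu.1)
  rcases le_or_gt (Kfun β u) (u * v) with h | h
  · exact le_iSup₂_of_le (f := fun u (_ : u ∈ Set.Icc (0 : ℝ) (Kminus β v)) =>
      ENNReal.ofReal (u * v - Kfun β u)) u ⟨hu, le_csSup hbdd ⟨hu, h⟩⟩ le_rfl
  · rw [ENNReal.ofReal_of_nonpos (sub_nonpos.mpr h.le)]
    exact zero_le

/-- Lemma (properties of the convex conjugate `K*`). -/
theorem stmt2 (a : ℝ) (ha : 0 < a) (β : ℝ → ℝ)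
    (hβ0 : ∀ s : ℝ, 0 < s → 0 ≤ β s)
    (hβdec : AntitoneOn β (Set.Ioi 0))
    (hβlim : Tendsto β atTop (nhds 0)) :
    -- (i) `K*(0) = 0` and `K*(v) > 0` for `v > 0`
    (Kstar β 0 = 0 ∧ ∀ v : ℝ, 0 < v → 0 < Kstar β v) ∧
    -- (ii) `K*` is convex
    (∀ v₁ v₂ : ℝ, 0 ≤ v₁ → 0 ≤ v₂ → ∀ t : ℝ, 0 ≤ t → t ≤ 1 →
      Kstar β (t * v₁ + (1 - t) * v₂) ≤
        ENNReal.ofReal t * Kstar β v₁ + ENNReal.ofReal (1 - t) * Kstar β v₂) ∧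
    -- (iii) `v ↦ K*(v)/v` is increasing on `(0,∞)`
    (∀ v₁ v₂ : ℝ, 0 < v₁ → v₁ ≤ v₂ →
      Kstar β v₁ / ENNReal.ofReal v₁ ≤ Kstar β v₂ / ENNReal.ofReal v₂) ∧
    -- (iv) under `β(s) ≥ a(1−s)` on `(0,1)`: `K*(v) ≤ v` on `[0,a]`; and for `v ∈ [0,a)`,
    -- `K⁻(v)` is finite and the supremum defining `K*(v)` can be restricted to `[0, K⁻(v)]`
    ((∀ s ∈ Set.Ioo (0 : ℝ) 1, a * (1 - s) ≤ β s) →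
      (∀ v ∈ Set.Icc (0 : ℝ) a, Kstar β v ≤ ENNReal.ofReal v) ∧
      ∀ v ∈ Set.Ico (0 : ℝ) a,
        BddAbove {u : ℝ | 0 ≤ u ∧ Kfun β u ≤ u * v} ∧
        Kstar β v = ⨆ u ∈ Set.Icc (0 : ℝ) (Kminus β v), ENNReal.ofReal (u * v - Kfun β u)) := by
  exact ⟨⟨Kstar_zero hβ0, fun _ hv => Kstar_pos hβlim hv⟩,
    fun v₁ v₂ _ _ _ ht0 ht1 => Kstar_convex β v₁ v₂ ht0 ht1,
    fun _ _ hv₁ hv => Kstar_div_mono hβ0 hv₁ hv,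
    fun hβ => ⟨fun _ hv => Kstar_le_ofReal hβ0 hβ hv.1 hv.2, fun _ hv =>
      ⟨bddAbove_Kfun_le_mul hβ hv.2, Kstar_eq_iSup_Icc_Kminus (bddAbove_Kfun_le_mul hβ hv.2)⟩⟩⟩
end

section
/- Let c₀, c₁ > 0 and β(s) := c₀·s^{−c₁} for s > 0. Then for all v ≥ 0, K*(v) = C(c₀,c₁)·v^{1+1/c₁} with C(c₀,c₁) := c₀c₁/(c₀(1+c₁))^{1+1/c₁}, the function F_∞(x) = ∫_x^∞ dv/K*(v) is finite for every x > 0, and its inverse satisfies F_∞⁻¹(n) ≤ c₀·(1+c₁)^{1+c₁}·n^{−c₁} for every n > 0. -/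
open MeasureTheory Filter
open scoped ENNReal

/-- `F_∞(x) := ∫_x^∞ dv / K*(v)`. -/
noncomputable def Finfty (β : ℝ → ℝ) (x : ℝ) : ℝ :=
  (∫⁻ v in Set.Ioi x, (Kstar β v)⁻¹).toReal

theorem Kfun_power {c₀ c₁ u : ℝ} (hc₁ : 0 < c₁) (hu : 0 ≤ u) :
    Kfun (fun s : ℝ => c₀ * s ^ (-c₁)) u = c₀ * u ^ (1 + c₁) := by
  rcases hu.eq_or_lt with rfl | hu
  · rw [Real.zero_rpow (by positivity)]
    simp [Kfun]
  · rw [Kfun, if_neg hu.ne', Real.inv_rpow hu.le, Real.rpow_neg hu.le, inv_inv,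
      Real.rpow_add hu, Real.rpow_one]
    ring

/-- Young's inequality for the exponents `1 + c₁` and `1 + 1 / c₁`. -/
theorem one_add_mul_mul_le_rpow_add {c₁ u b : ℝ} (hc₁ : 0 < c₁) (hu : 0 ≤ u) (hb : 0 ≤ b) :
    (1 + c₁) * (u * b) ≤ u ^ (1 + c₁) + c₁ * b ^ (1 + 1 / c₁) := by
  have hpq : (1 + c₁).HolderConjugate (1 + 1 / c₁) := by
    rw [Real.holderConjugate_iff]
    exact ⟨by linarith, by field_simp; ring⟩
  have h := mul_le_mul_of_nonneg_left (Real.young_inequality_of_nonneg hu hb hpq)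
    (by positivity : 0 ≤ 1 + c₁)
  refine h.trans_eq ?_
  field_simp
  ring

theorem Kstar_power {c₀ c₁ v : ℝ} (hc₀ : 0 < c₀) (hc₁ : 0 < c₁) (hv : 0 ≤ v) :
    Kstar (fun s : ℝ => c₀ * s ^ (-c₁)) v =
      ENNReal.ofReal (c₀ * c₁ / (c₀ * (1 + c₁)) ^ (1 + 1 / c₁) * v ^ (1 + 1 / c₁)) := by
  obtain ⟨b, hb, rfl⟩ : ∃ b, 0 ≤ b ∧ v = c₀ * (1 + c₁) * b :=
    ⟨v / (c₀ * (1 + c₁)), by positivity, by field_simp⟩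
  have hval : c₀ * c₁ / (c₀ * (1 + c₁)) ^ (1 + 1 / c₁) *
      (c₀ * (1 + c₁) * b) ^ (1 + 1 / c₁) = c₀ * c₁ * b ^ (1 + 1 / c₁) := by
    rw [Real.mul_rpow (by positivity) hb]
    field_simp
  rw [hval, Kstar]
  apply le_antisymm
  · refine iSup₂_le fun u hu => ENNReal.ofReal_le_ofReal ?_
    rw [Kfun_power hc₁ hu]
    nlinarith [mul_le_mul_of_nonneg_left (one_add_mul_mul_le_rpow_add hc₁ hu hb) hc₀.le]
  · have hw : 0 ≤ b ^ (1 / c₁) := by positivity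
    refine le_iSup₂_of_le (b ^ (1 / c₁)) hw (ENNReal.ofReal_le_ofReal (le_of_eq ?_))
    have h₁ : (b ^ (1 / c₁)) ^ (1 + c₁) = b ^ (1 + 1 / c₁) := by
      rw [← Real.rpow_mul hb]
      congr 1
      field_simp
      ring
    have h₂ : b ^ (1 + 1 / c₁) = b * b ^ (1 / c₁) := by
      rw [Real.rpow_add' hb (by positivity), Real.rpow_one]
    rw [Kfun_power hc₁ hw, h₁, h₂]
    ring

theorem lintegral_Ioi_inv_ofReal_mul_rpow {C q x : ℝ} (hC : 0 < C) (hq : 0 < q) (hx : 0 < x) :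
    ∫⁻ v in Set.Ioi x, (ENNReal.ofReal (C * v ^ (1 + q)))⁻¹ =
      ENNReal.ofReal (C⁻¹ * (x ^ (-q) / q)) := by
  have hint := (integrableOn_Ioi_rpow_of_lt (by linarith : -(1 + q) < -1) hx).const_mul C⁻¹
  have hnonneg : 0 ≤ᵐ[volume.restrict (Set.Ioi x)] fun v : ℝ => C⁻¹ * v ^ (-(1 + q)) := by
    filter_upwards [ae_restrict_mem measurableSet_Ioi] with v hv
    have : 0 < v := hx.trans hv
    simp only [Pi.zero_apply]
    positivity
  calc ∫⁻ v in Set.Ioi x, (ENNReal.ofReal (C * v ^ (1 + q)))⁻¹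
      = ∫⁻ v in Set.Ioi x, ENNReal.ofReal (C⁻¹ * v ^ (-(1 + q))) := by
        refine setLIntegral_congr_fun measurableSet_Ioi fun v hv => ?_
        have hv₀ : 0 < v := hx.trans hv
        rw [← ENNReal.ofReal_inv_of_pos (by positivity), mul_inv, Real.rpow_neg hv₀.le]
    _ = ENNReal.ofReal (C⁻¹ * (x ^ (-q) / q)) := by
        rw [← ofReal_integral_eq_lintegral_ofReal hint hnonneg, integral_const_mul,
          integral_Ioi_rpow_of_lt (by linarith) hx]
        rw [show -(1 + q) + 1 = -q by ring, neg_div_neg_eq]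

theorem lintegral_Ioi_inv_Kstar_power {c₀ c₁ x : ℝ} (hc₀ : 0 < c₀) (hc₁ : 0 < c₁) (hx : 0 < x) :
    ∫⁻ v in Set.Ioi x, (Kstar (fun s : ℝ => c₀ * s ^ (-c₁)) v)⁻¹ =
      ENNReal.ofReal ((c₀ * (1 + c₁)) ^ (1 + 1 / c₁) / c₀ * x ^ (-(1 / c₁))) := by
  have hcongr : Set.EqOn (fun v => (Kstar (fun s : ℝ => c₀ * s ^ (-c₁)) v)⁻¹)
      (fun v => (ENNReal.ofReal
        (c₀ * c₁ / (c₀ * (1 + c₁)) ^ (1 + 1 / c₁) * v ^ (1 + 1 / c₁)))⁻¹) (Set.Ioi x) :=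
    fun v hv => congrArg _ (Kstar_power hc₀ hc₁ (hx.trans hv).le)
  rw [setLIntegral_congr_fun measurableSet_Ioi hcongr,
    lintegral_Ioi_inv_ofReal_mul_rpow (by positivity) (by positivity) hx]
  congr 1
  field_simp

/-- Explicit inversion of `F_∞`. -/
theorem eq_of_Finfty_power_eq {c₀ c₁ x n : ℝ} (hc₀ : 0 < c₀) (hc₁ : 0 < c₁) (hx : 0 < x)
    (h : Finfty (fun s : ℝ => c₀ * s ^ (-c₁)) x = n) :
    x = c₀ * (1 + c₁) ^ (1 + c₁) * n ^ (-c₁) := by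
  rw [Finfty, lintegral_Ioi_inv_Kstar_power hc₀ hc₁ hx,
    ENNReal.toReal_ofReal (by positivity)] at h
  have hD : 0 < c₀ * (1 + c₁) := by positivity
  have h₁ : (1 + 1 / c₁) * -c₁ = -(1 + c₁) := by
    field_simp
    ring
  have h₂ : -(1 / c₁) * -c₁ = 1 := by field_simp
  rw [← h, Real.mul_rpow (by positivity) (by positivity),
    Real.div_rpow (by positivity) hc₀.le, ← Real.rpow_mul hD.le, ← Real.rpow_mul hx.le, h₁, h₂,
    Real.rpow_one, Real.rpow_neg hD.le, Real.rpow_neg hc₀.le,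
    Real.mul_rpow hc₀.le (by positivity), Real.rpow_add hc₀, Real.rpow_one]
  field_simp

/-- Lemma (polynomially decaying `β`): for `β(s) = c₀ s^{-c₁}`,
`K*(v) = C(c₀,c₁) v^{1+1/c₁}`, `F_∞` is finite, and `F_∞⁻¹(n) ≤ c₀(1+c₁)^{1+c₁} n^{-c₁}`. -/
theorem stmt4 (c₀ c₁ : ℝ) (hc₀ : 0 < c₀) (hc₁ : 0 < c₁)
    (β : ℝ → ℝ) (hβ : β = fun s : ℝ => c₀ * s ^ (-c₁)) :
    (∀ v : ℝ, 0 ≤ v →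
      Kstar β v =
        ENNReal.ofReal (c₀ * c₁ / (c₀ * (1 + c₁)) ^ (1 + 1 / c₁) * v ^ (1 + 1 / c₁))) ∧
    (∀ x : ℝ, 0 < x → (∫⁻ v in Set.Ioi x, (Kstar β v)⁻¹) ≠ ∞) ∧
    ∀ Finv : ℝ → ℝ,
      (∀ x : ℝ, 0 < x → 0 < Finv x ∧ Finfty β (Finv x) = x) →
      ∀ n : ℝ, 0 < n → Finv n ≤ c₀ * (1 + c₁) ^ (1 + c₁) * n ^ (-c₁) := by
  subst hβ
  refine ⟨fun v hv => Kstar_power hc₀ hc₁ hv, fun x hx => ?_, fun Finv hF n hn => ?_⟩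
  · rw [lintegral_Ioi_inv_Kstar_power hc₀ hc₁ hx]
    exact ENNReal.ofReal_ne_top
  · exact (eq_of_Finfty_power_eq hc₀ hc₁ (hF n hn).1 (hF n hn).2).le
end

section
/- Let P be a self-adjoint bounded linear operator on L²(μ) mapping L²₀(μ) into itself, let Φ : L²(μ) → [0,∞] be a functional, and let γ : ℝ₊ → (0,∞) be decreasing with γ(s) → 0 as s → ∞. Assume that for every n ∈ ℕ and every f ∈ L²₀(μ), ‖Pⁿf‖₂² ≤ γ(n)·Φ(f). Then for every f ∈ L²₀(μ) with 0 < Φ(f) < ∞ and every s > 1, ‖f‖₂² ≤ s·(‖f‖₂² − ‖Pf‖₂²) + β₁(s)·Φ(f), where β₁(s) := sup_{t ≥ s} inf_{n ≥ 2} { (tⁿ/(t−1)^{n−1}) · ((n−1)^{n−1}/nⁿ) · γ(n) }; moreover β₁ is decreasing on (1,∞) and β₁(s) → 0 as s → ∞. -/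
open MeasureTheory Filter
open scoped ENNReal

/-- The function `β₁(s) := sup_{t ≥ s} inf_{n ≥ 2} (tⁿ/(t−1)^{n−1})·((n−1)^{n−1}/nⁿ)·γ(n)`. -/
noncomputable def beta1 (γ : ℝ → ℝ) (s : ℝ) : ℝ :=
  sSup {y : ℝ | ∃ t : ℝ, s ≤ t ∧
    y = sInf {z : ℝ | ∃ n : ℕ, 2 ≤ n ∧
      z = t ^ n / (t - 1) ^ (n - 1) * (((n : ℝ) - 1) ^ (n - 1) / (n : ℝ) ^ n) * γ (n : ℝ)}}

/-- The squared norms of the orbit of a symmetric operator are log-convex, so that the first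
ratio is the smallest one. -/
theorem norm_sq_mul_norm_sq_pow_apply_le {H : Type*} [NormedAddCommGroup H]
    [InnerProductSpace ℝ H] (P : H →L[ℝ] H)
    (hsa : ∀ f g : H, inner ℝ (P f) g = inner ℝ f (P g)) (f : H) (n : ℕ) :
    ‖P f‖ ^ 2 * ‖(P ^ n) f‖ ^ 2 ≤ ‖f‖ ^ 2 * ‖(P ^ (n + 1)) f‖ ^ 2 := by
  induction n with
  | zero => simp [mul_comm]
  | succ n ih =>
    have hsucc : ∀ k, (P ^ (k + 1)) f = P ((P ^ k) f) := fun k => by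
      rw [pow_succ']; rfl
    rcases eq_or_ne ((P ^ n) f) 0 with h0 | h0
    · simp [hsucc, h0]
    · have hpos : 0 < ‖(P ^ n) f‖ ^ 2 := by positivity
      have hcs : ‖(P ^ (n + 1)) f‖ ^ 2 ≤ ‖(P ^ n) f‖ * ‖(P ^ (n + 1 + 1)) f‖ := by
        rw [← real_inner_self_eq_norm_sq]
        nth_rewrite 1 [hsucc n]
        rw [hsa, ← hsucc]
        exact real_inner_le_norm _ _
      have hcs2 : ‖(P ^ (n + 1)) f‖ ^ 2 * ‖(P ^ (n + 1)) f‖ ^ 2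
          ≤ ‖(P ^ n) f‖ ^ 2 * ‖(P ^ (n + 1 + 1)) f‖ ^ 2 :=
        (mul_le_mul hcs hcs (by positivity) (by positivity)).trans_eq (by ring)
      refine le_of_mul_le_mul_left ?_ hpos
      calc ‖(P ^ n) f‖ ^ 2 * (‖P f‖ ^ 2 * ‖(P ^ (n + 1)) f‖ ^ 2)
          = ‖P f‖ ^ 2 * ‖(P ^ n) f‖ ^ 2 * ‖(P ^ (n + 1)) f‖ ^ 2 := by ring
        _ ≤ ‖f‖ ^ 2 * ‖(P ^ (n + 1)) f‖ ^ 2 * ‖(P ^ (n + 1)) f‖ ^ 2 := by gcongr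
        _ = ‖f‖ ^ 2 * (‖(P ^ (n + 1)) f‖ ^ 2 * ‖(P ^ (n + 1)) f‖ ^ 2) := by ring
        _ ≤ ‖f‖ ^ 2 * (‖(P ^ n) f‖ ^ 2 * ‖(P ^ (n + 1 + 1)) f‖ ^ 2) := by gcongr
        _ = _ := by ring

theorem norm_sq_ratio_pow_mul_le {H : Type*} [NormedAddCommGroup H]
    [InnerProductSpace ℝ H] (P : H →L[ℝ] H)
    (hsa : ∀ f g : H, inner ℝ (P f) g = inner ℝ f (P g)) {f : H} (hf : f ≠ 0) (n : ℕ) :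
    (‖P f‖ ^ 2 / ‖f‖ ^ 2) ^ n * ‖f‖ ^ 2 ≤ ‖(P ^ n) f‖ ^ 2 := by
  have hpos : 0 < ‖f‖ ^ 2 := by positivity
  induction n with
  | zero => simp
  | succ n ih =>
    calc (‖P f‖ ^ 2 / ‖f‖ ^ 2) ^ (n + 1) * ‖f‖ ^ 2
        = ‖P f‖ ^ 2 / ‖f‖ ^ 2 * ((‖P f‖ ^ 2 / ‖f‖ ^ 2) ^ n * ‖f‖ ^ 2) := by ring
      _ ≤ ‖P f‖ ^ 2 / ‖f‖ ^ 2 * ‖(P ^ n) f‖ ^ 2 := by gcongr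
      _ ≤ ‖(P ^ (n + 1)) f‖ ^ 2 := by
        rw [div_mul_eq_mul_div, div_le_iff₀ hpos, mul_comm (‖(P ^ (n + 1)) f‖ ^ 2)]
        exact norm_sq_mul_norm_sq_pow_apply_le P hsa f n

/-- The tangent-line inequality behind the constant in `beta1`. -/
theorem one_sub_mul_one_sub_le_mul_pow {t r : ℝ} (ht : 1 < t) (hr : 0 ≤ r) {n : ℕ}
    (hn : 2 ≤ n) :
    1 - t * (1 - r) ≤
      t ^ n / (t - 1) ^ (n - 1) * (((n : ℝ) - 1) ^ (n - 1) / (n : ℝ) ^ n) * r ^ n := by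
  obtain ⟨m, rfl⟩ : ∃ m, n = m + 1 := ⟨n - 1, by omega⟩
  have hm : (0 : ℝ) < m := by exact_mod_cast (by omega : 0 < m)
  have ht' : 0 < t - 1 := by linarith
  have hn' : (0 : ℝ) < m + 1 := by positivity
  simp only [Nat.add_sub_cancel, Nat.cast_add, Nat.cast_one, add_sub_cancel_right]
  set y : ℝ := t * r * m / ((t - 1) * (m + 1)) with hy
  have hy0 : 0 ≤ y := by positivity
  have hbern := one_add_mul_sub_le_pow (a := y) (by linarith) (m + 1)
  push_cast at hbern
  calc 1 - t * (1 - r) = (t - 1) / m * (1 + ((m : ℝ) + 1) * (y - 1)) := by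
        rw [hy]; field_simp; ring
    _ ≤ (t - 1) / m * y ^ (m + 1) := by gcongr
    _ = _ := by
        rw [hy, div_pow, mul_pow, mul_pow, mul_pow]
        field_simp
        ring

/-- The set of values over which the infimum in `beta1` is taken. -/
def beta1Values (γ : ℝ → ℝ) (t : ℝ) : Set ℝ :=
  {z : ℝ | ∃ n : ℕ, 2 ≤ n ∧
    z = t ^ n / (t - 1) ^ (n - 1) * (((n : ℝ) - 1) ^ (n - 1) / (n : ℝ) ^ n) * γ (n : ℝ)}

theorem beta1_eq (γ : ℝ → ℝ) (s : ℝ) :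
    beta1 γ s = sSup {y : ℝ | ∃ t : ℝ, s ≤ t ∧ y = sInf (beta1Values γ t)} := rfl

theorem beta1Values_nonempty (γ : ℝ → ℝ) (t : ℝ) : (beta1Values γ t).Nonempty :=
  ⟨_, 2, le_rfl, rfl⟩

theorem nonneg_of_mem_beta1Values {γ : ℝ → ℝ} (hγpos : ∀ s : ℝ, 0 < s → 0 < γ s)
    {t z : ℝ} (ht : 1 < t) (hz : z ∈ beta1Values γ t) :
    0 ≤ z := by
  obtain ⟨n, hn, rfl⟩ := hz
  have hn2 : (2 : ℝ) ≤ n := by exact_mod_cast hn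
  have h1 : 0 < t - 1 := by linarith
  have h2 : (0 : ℝ) < (n : ℝ) - 1 := by linarith
  have h3 := hγpos n (by linarith)
  positivity

theorem sInf_beta1Values_nonneg {γ : ℝ → ℝ} (hγpos : ∀ s : ℝ, 0 < s → 0 < γ s)
    {t : ℝ} (ht : 1 < t) : 0 ≤ sInf (beta1Values γ t) :=
  Real.sInf_nonneg fun _ hz => nonneg_of_mem_beta1Values hγpos ht hz

theorem sInf_beta1Values_le {γ : ℝ → ℝ} (hγpos : ∀ s : ℝ, 0 < s → 0 < γ s)
    (hγdec : AntitoneOn γ (Set.Ioi 0)) {t : ℝ} (ht : 1 < t) :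
    sInf (beta1Values γ t) ≤ Real.exp (1 / (t - 1)) * γ t := by
  have hceil : t ≤ (⌈t⌉₊ : ℝ) := Nat.le_ceil t
  have hceil' : (⌈t⌉₊ : ℝ) < t + 1 := Nat.ceil_lt_add_one (by linarith)
  have hn : 2 ≤ ⌈t⌉₊ := by
    have : (1 : ℝ) < ⌈t⌉₊ := by linarith
    exact_mod_cast this
  have hbdd : BddBelow (beta1Values γ t) :=
    ⟨0, fun _ hz => nonneg_of_mem_beta1Values hγpos ht hz⟩
  refine (csInf_le hbdd ⟨⌈t⌉₊, hn, rfl⟩).trans ?_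
  obtain ⟨m, hm⟩ : ∃ m, ⌈t⌉₊ = m + 1 := ⟨⌈t⌉₊ - 1, by omega⟩
  rw [hm] at hceil hceil' hn ⊢
  have hγ : γ ((m + 1 : ℕ) : ℝ) ≤ γ t :=
    hγdec (Set.mem_Ioi.2 (by linarith)) (Set.mem_Ioi.2 (by positivity)) hceil
  have hγ0 := hγpos ((m + 1 : ℕ) : ℝ) (by positivity)
  push_cast at hceil hceil' hγ hγ0 ⊢
  simp only [add_sub_cancel_right]
  have hm0 : (0 : ℝ) < m := by linarith
  have ht' : 0 < t - 1 := by linarith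
  have hbase : t * m / ((t - 1) * (m + 1)) ≤ Real.exp (1 / ((t - 1) * (m + 1))) := by
    refine le_trans ?_ (Real.add_one_le_exp _)
    rw [div_add_one (by positivity)]
    gcongr
    nlinarith
  refine mul_le_mul ?_ hγ hγ0.le (Real.exp_pos _).le
  calc t ^ (m + 1) / (t - 1) ^ m * ((m : ℝ) ^ m / ((m : ℝ) + 1) ^ (m + 1))
      = t / (m + 1) * (t * m / ((t - 1) * (m + 1))) ^ m := by
        rw [div_pow, mul_pow, mul_pow]; field_simp; ring
    _ ≤ 1 * Real.exp (1 / ((t - 1) * (m + 1))) ^ m := by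
        gcongr
        exact (div_le_one (by positivity)).2 hceil
    _ = Real.exp (m * (1 / ((t - 1) * (m + 1)))) := by rw [one_mul, ← Real.exp_nat_mul]
    _ ≤ Real.exp (1 / (t - 1)) := by
        gcongr
        rw [mul_one_div, div_le_div_iff₀ (by positivity) ht']
        nlinarith

theorem sInf_beta1Values_le_of_le {γ : ℝ → ℝ} (hγpos : ∀ s : ℝ, 0 < s → 0 < γ s)
    (hγdec : AntitoneOn γ (Set.Ioi 0)) {s t : ℝ} (hs : 1 < s) (hst : s ≤ t) :
    sInf (beta1Values γ t) ≤ Real.exp (1 / (s - 1)) * γ s := by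
  have hs' : 0 < s - 1 := by linarith
  have hγ0 := hγpos t (by linarith)
  have hγ : γ t ≤ γ s := hγdec (Set.mem_Ioi.2 (by linarith)) (Set.mem_Ioi.2 (by linarith)) hst
  refine (sInf_beta1Values_le hγpos hγdec (hs.trans_le hst)).trans ?_
  gcongr

theorem sInf_beta1Values_le_beta1 {γ : ℝ → ℝ} (hγpos : ∀ s : ℝ, 0 < s → 0 < γ s)
    (hγdec : AntitoneOn γ (Set.Ioi 0)) {s t : ℝ} (hs : 1 < s) (hst : s ≤ t) :
    sInf (beta1Values γ t) ≤ beta1 γ s := by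
  rw [beta1_eq]
  refine le_csSup ⟨Real.exp (1 / (s - 1)) * γ s, ?_⟩ ⟨t, hst, rfl⟩
  rintro _ ⟨u, hu, rfl⟩
  exact sInf_beta1Values_le_of_le hγpos hγdec hs hu

theorem beta1_le {γ : ℝ → ℝ} (hγpos : ∀ s : ℝ, 0 < s → 0 < γ s)
    (hγdec : AntitoneOn γ (Set.Ioi 0)) {s : ℝ} (hs : 1 < s) : beta1 γ s ≤ Real.exp (1 / (s - 1)) * γ s := by
  rw [beta1_eq]
  refine csSup_le ⟨_, s, le_rfl, rfl⟩ ?_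
  rintro _ ⟨u, hu, rfl⟩
  exact sInf_beta1Values_le_of_le hγpos hγdec hs hu

theorem beta1_nonneg {γ : ℝ → ℝ} (hγpos : ∀ s : ℝ, 0 < s → 0 < γ s)
    (hγdec : AntitoneOn γ (Set.Ioi 0)) {s : ℝ} (hs : 1 < s) : 0 ≤ beta1 γ s :=
  (sInf_beta1Values_nonneg hγpos hs).trans (sInf_beta1Values_le_beta1 hγpos hγdec hs le_rfl)

theorem antitoneOn_beta1 {γ : ℝ → ℝ} (hγpos : ∀ s : ℝ, 0 < s → 0 < γ s)
    (hγdec : AntitoneOn γ (Set.Ioi 0)) : AntitoneOn (beta1 γ) (Set.Ioi 1) := by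
  intro a ha b _ hab
  rw [beta1_eq γ b]
  refine csSup_le ⟨_, b, le_rfl, rfl⟩ ?_
  rintro _ ⟨u, hu, rfl⟩
  exact sInf_beta1Values_le_beta1 hγpos hγdec ha (hab.trans hu)

theorem tendsto_beta1 {γ : ℝ → ℝ} (hγpos : ∀ s : ℝ, 0 < s → 0 < γ s)
    (hγdec : AntitoneOn γ (Set.Ioi 0)) (hγlim : Tendsto γ atTop (nhds 0)) :
    Tendsto (beta1 γ) atTop (nhds 0) := by
  have hexp : Tendsto (fun s : ℝ => Real.exp (1 / (s - 1)) * γ s) atTop (nhds 0) := by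
    have h1 : Tendsto (fun s : ℝ => 1 / (s - 1)) atTop (nhds 0) := by
      simp only [one_div, sub_eq_add_neg]
      exact (tendsto_atTop_add_const_right atTop (-1 : ℝ) tendsto_id).inv_tendsto_atTop
    simpa using ((Real.continuous_exp.tendsto 0).comp h1).mul hγlim
  refine squeeze_zero' ?_ ?_ hexp
  · filter_upwards [eventually_gt_atTop 1] with s hs using beta1_nonneg hγpos hγdec hs
  · filter_upwards [eventually_gt_atTop 1] with s hs using beta1_le hγpos hγdec hs

/-- Proposition (necessity of super-Poincaré inequalities in the reversible case):
subgeometric convergence `‖Pⁿf‖₂² ≤ γ(n)Φ(f)` implies that `P²` satisfies a super-Poincaré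
inequality with function `β₁`, which is decreasing to `0`. -/
theorem stmt8 {E : Type*} [MeasurableSpace E] (μ : Measure E) [IsProbabilityMeasure μ]
    (P : Lp ℝ 2 μ →L[ℝ] Lp ℝ 2 μ)
    (hsa : ∀ f g : Lp ℝ 2 μ, @inner ℝ _ _ (P f) g = @inner ℝ _ _ f (P g))
    (L20 : Set (Lp ℝ 2 μ)) (hL20 : L20 = {f : Lp ℝ 2 μ | ∫ x, f x ∂μ = 0})
    (hP0 : ∀ f ∈ L20, P f ∈ L20)
    (Φ : Lp ℝ 2 μ → ℝ≥0∞)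
    (γ : ℝ → ℝ) (hγpos : ∀ s : ℝ, 0 < s → 0 < γ s)
    (hγdec : AntitoneOn γ (Set.Ioi 0))
    (hγlim : Tendsto γ atTop (nhds 0))
    (hconv : ∀ n : ℕ, 1 ≤ n → ∀ f ∈ L20, Φ f ≠ ∞ →
      ‖(P ^ n) f‖ ^ 2 ≤ γ (n : ℝ) * (Φ f).toReal) :
    (∀ f ∈ L20, Φ f ≠ ∞ → ∀ s : ℝ, 1 < s →
      ‖f‖ ^ 2 ≤ s * (‖f‖ ^ 2 - ‖P f‖ ^ 2) + beta1 γ s * (Φ f).toReal) ∧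
    AntitoneOn (beta1 γ) (Set.Ioi 1) ∧
    Tendsto (beta1 γ) atTop (nhds 0) := by
  refine ⟨fun f hf hΦ s hs => ?_, antitoneOn_beta1 hγpos hγdec, tendsto_beta1 hγpos hγdec hγlim⟩
  have hΦ0 : 0 ≤ (Φ f).toReal := ENNReal.toReal_nonneg
  rcases eq_or_ne f 0 with rfl | hf0
  · simpa using mul_nonneg (beta1_nonneg hγpos hγdec hs) hΦ0
  have hpos : 0 < ‖f‖ ^ 2 := by positivity
  set r : ℝ := ‖P f‖ ^ 2 / ‖f‖ ^ 2 with hr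
  have hr0 : 0 ≤ r := by positivity
  have hs' : 0 < s - 1 := by linarith
  have hPf : ‖P f‖ ^ 2 = r * ‖f‖ ^ 2 := by rw [hr]; field_simp
  have key : ∀ z ∈ beta1Values γ s,
      (1 - s * (1 - r)) * ‖f‖ ^ 2 ≤ z * (Φ f).toReal := by
    rintro _ ⟨n, hn, rfl⟩
    have hn2 : (2 : ℝ) ≤ n := by exact_mod_cast hn
    have hn1 : (0 : ℝ) < (n : ℝ) - 1 := by linarith
    have hle : r ^ n * ‖f‖ ^ 2 ≤ γ n * (Φ f).toReal :=
      (norm_sq_ratio_pow_mul_le P hsa hf0 n).trans (hconv n (by omega) f hf hΦ)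
    refine (mul_le_mul_of_nonneg_right
      (one_sub_mul_one_sub_le_mul_pow hs hr0 hn) hpos.le).trans ?_
    rw [mul_assoc, mul_assoc _ (γ n)]
    exact mul_le_mul_of_nonneg_left hle (by positivity)
  have hinf : (1 - s * (1 - r)) * ‖f‖ ^ 2 ≤ sInf (beta1Values γ s) * (Φ f).toReal := by
    rcases hΦ0.eq_or_lt with h0 | h0
    · obtain ⟨z, hz⟩ := beta1Values_nonempty γ s
      simpa [← h0] using key z hz
    · rw [← div_le_iff₀ h0]
      exact le_csInf (beta1Values_nonempty γ s) fun z hz => (div_le_iff₀ h0).2 (key z hz)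
  have hbeta := mul_le_mul_of_nonneg_right
    (sInf_beta1Values_le_beta1 hγpos hγdec hs le_rfl) hΦ0
  rw [hPf]
  linarith
end

section
/- Let μ be a probability measure, let T₁ and T₂ be bounded linear operators on L²(μ), let Φ₁, Φ₂ : L²(μ) → [0,∞], and let β₁, β₂ : (0,∞) → (0,∞) be decreasing with β₁(s), β₂(s) → 0 as s → ∞. Assume that for all f ∈ L²₀(μ) and all s > 0: ‖f‖₂² ≤ s·E(T₁,f) + β₁(s)·Φ₁(f) and E(T₁,f) ≤ s·E(T₂,f) + β₂(s)·Φ₂(f). Then for all f ∈ L²₀(μ) and all s > 0, ‖f‖₂² ≤ s·E(T₂,f) + β(s)·Φ(f), where Φ := max(Φ₁,Φ₂) and β(s) := inf{ s₁·β₂(s₂) + β₁(s₁) : s₁ > 0, s₂ > 0, s₁s₂ = s }; moreover β is decreasing on (0,∞) and β(s) → 0 as s → ∞. -/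
open MeasureTheory Filter
open scoped ENNReal RealInnerProductSpace

/-- `β(s) := inf { s₁β₂(s₂) + β₁(s₁) : s₁, s₂ > 0, s₁s₂ = s }`. -/
noncomputable def betaComb (β₁ β₂ : ℝ → ℝ) (s : ℝ) : ℝ :=
  sInf {y : ℝ | ∃ s₁ s₂ : ℝ, 0 < s₁ ∧ 0 < s₂ ∧ s₁ * s₂ = s ∧ y = s₁ * β₂ s₂ + β₁ s₁}

/-- Each admissible pair bounds `betaComb` from above. -/
theorem betaComb_le {β₁ β₂ : ℝ → ℝ} (hβ₁ : ∀ s : ℝ, 0 < s → 0 < β₁ s)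
    (hβ₂ : ∀ s : ℝ, 0 < s → 0 < β₂ s) {s₁ s₂ : ℝ} (h₁ : 0 < s₁) (h₂ : 0 < s₂) :
    betaComb β₁ β₂ (s₁ * s₂) ≤ s₁ * β₂ s₂ + β₁ s₁ := by
  refine csInf_le ⟨0, ?_⟩ ⟨s₁, s₂, h₁, h₂, rfl, rfl⟩
  rintro y ⟨a, b, ha, hb, -, rfl⟩
  have := hβ₁ a ha
  have := hβ₂ b hb
  positivity

/-- A common lower bound over the admissible pairs is a lower bound of `betaComb`. -/
theorem le_betaComb {β₁ β₂ : ℝ → ℝ} {s c : ℝ} (hs : 0 < s)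
    (h : ∀ s₁ s₂ : ℝ, 0 < s₁ → 0 < s₂ → s₁ * s₂ = s → c ≤ s₁ * β₂ s₂ + β₁ s₁) :
    c ≤ betaComb β₁ β₂ s := by
  refine le_csInf ⟨_, 1, s, one_pos, hs, one_mul s, rfl⟩ ?_
  rintro y ⟨a, b, ha, hb, hab, rfl⟩
  exact h a b ha hb hab

theorem betaComb_nonneg {β₁ β₂ : ℝ → ℝ} (hβ₁ : ∀ s : ℝ, 0 < s → 0 < β₁ s)
    (hβ₂ : ∀ s : ℝ, 0 < s → 0 < β₂ s) {s : ℝ} (hs : 0 < s) : 0 ≤ betaComb β₁ β₂ s := by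
  refine le_betaComb hs fun a b ha hb _ => ?_
  have := hβ₁ a ha
  have := hβ₂ b hb
  positivity

theorem antitoneOn_betaComb {β₁ β₂ : ℝ → ℝ} (hβ₁ : ∀ s : ℝ, 0 < s → 0 < β₁ s)
    (hβ₂ : ∀ s : ℝ, 0 < s → 0 < β₂ s) (hβ₂dec : AntitoneOn β₂ (Set.Ioi 0)) :
    AntitoneOn (betaComb β₁ β₂) (Set.Ioi 0) := by
  intro s hs t ht hst
  refine le_betaComb hs fun a b ha hb hab => ?_
  have htpos : 0 < t / a := div_pos ht ha
  have hbt : b ≤ t / a := by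
    rw [le_div_iff₀ ha]
    linarith [mul_comm a b]
  have hle := betaComb_le hβ₁ hβ₂ ha htpos
  rw [mul_div_cancel₀ t ha.ne'] at hle
  have := mul_le_mul_of_nonneg_left (hβ₂dec hb htpos hbt) ha.le
  linarith

theorem tendsto_betaComb {β₁ β₂ : ℝ → ℝ} (hβ₁ : ∀ s : ℝ, 0 < s → 0 < β₁ s)
    (hβ₂ : ∀ s : ℝ, 0 < s → 0 < β₂ s) (hβ₁lim : Tendsto β₁ atTop (nhds 0))
    (hβ₂lim : Tendsto β₂ atTop (nhds 0)) : Tendsto (betaComb β₁ β₂) atTop (nhds 0) := by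
  refine tendsto_order.2 ⟨fun c hc => ?_, fun ε hε => ?_⟩
  · filter_upwards [eventually_gt_atTop 0] with s hs
    exact hc.trans_le (betaComb_nonneg hβ₁ hβ₂ hs)
  · obtain ⟨a, haε, ha⟩ :=
      ((hβ₁lim.eventually_lt_const hε).and (eventually_gt_atTop (0 : ℝ))).exists
    have hlim : Tendsto (fun s => a * β₂ (s / a) + β₁ a) atTop (nhds (a * 0 + β₁ a)) :=
      ((hβ₂lim.comp (tendsto_id.atTop_div_const ha)).const_mul a).add_const (β₁ a)
    rw [mul_zero, zero_add] at hlim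
    filter_upwards [hlim.eventually_lt_const haε, eventually_gt_atTop 0] with s hsε hs
    have hle := betaComb_le hβ₁ hβ₂ ha (div_pos hs ha)
    rw [mul_div_cancel₀ s ha.ne'] at hle
    exact hle.trans_lt hsε

/-- Passing to the infimum in a family of affine upper bounds with nonnegative slope. -/
theorem le_betaComb_mul {β₁ β₂ : ℝ → ℝ} {s c M : ℝ} (hs : 0 < s) (hM : 0 ≤ M)
    (h : ∀ s₁ s₂ : ℝ, 0 < s₁ → 0 < s₂ → s₁ * s₂ = s → c ≤ (s₁ * β₂ s₂ + β₁ s₁) * M) :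
    c ≤ betaComb β₁ β₂ s * M := by
  rcases hM.eq_or_lt with rfl | hM
  · simpa using h 1 s one_pos hs (one_mul s)
  · rw [← div_le_iff₀ hM]
    exact le_betaComb hs fun a b ha hb hab => (div_le_iff₀ hM).2 (h a b ha hb hab)

/-- Proposition (chaining two weak Poincaré inequalities). -/
theorem stmt11 {E : Type*} [MeasurableSpace E] (μ : Measure E) [IsProbabilityMeasure μ]
    (T₁ T₂ : Lp ℝ 2 μ →L[ℝ] Lp ℝ 2 μ)
    (L20 : Set (Lp ℝ 2 μ)) (hL20 : L20 = {f : Lp ℝ 2 μ | ∫ x, f x ∂μ = 0})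
    (Φ₁ Φ₂ : Lp ℝ 2 μ → ℝ≥0∞)
    (β₁ β₂ : ℝ → ℝ)
    (hβ₁pos : ∀ s : ℝ, 0 < s → 0 < β₁ s) (hβ₂pos : ∀ s : ℝ, 0 < s → 0 < β₂ s)
    (hβ₁dec : AntitoneOn β₁ (Set.Ioi 0)) (hβ₂dec : AntitoneOn β₂ (Set.Ioi 0))
    (hβ₁lim : Tendsto β₁ atTop (nhds 0)) (hβ₂lim : Tendsto β₂ atTop (nhds 0))
    (h1 : ∀ f ∈ L20, ∀ s : ℝ, 0 < s → Φ₁ f ≠ ∞ →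
      ‖f‖ ^ 2 ≤ s * ⟪f - T₁ f, f⟫ + β₁ s * (Φ₁ f).toReal)
    (h2 : ∀ f ∈ L20, ∀ s : ℝ, 0 < s → Φ₂ f ≠ ∞ →
      ⟪f - T₁ f, f⟫ ≤ s * ⟪f - T₂ f, f⟫ + β₂ s * (Φ₂ f).toReal) :
    (∀ f ∈ L20, ∀ s : ℝ, 0 < s → Φ₁ f ≠ ∞ → Φ₂ f ≠ ∞ →
      ‖f‖ ^ 2 ≤ s * ⟪f - T₂ f, f⟫ + betaComb β₁ β₂ s * (max (Φ₁ f) (Φ₂ f)).toReal) ∧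
    AntitoneOn (betaComb β₁ β₂) (Set.Ioi 0) ∧
    Tendsto (betaComb β₁ β₂) atTop (nhds 0) := by
  refine ⟨fun f hf s hs hΦ₁ hΦ₂ => ?_, antitoneOn_betaComb hβ₁pos hβ₂pos hβ₂dec,
    tendsto_betaComb hβ₁pos hβ₂pos hβ₁lim hβ₂lim⟩
  have hmax : max (Φ₁ f) (Φ₂ f) ≠ ∞ := (max_lt hΦ₁.lt_top hΦ₂.lt_top).ne
  have hM₁ := ENNReal.toReal_mono hmax (le_max_left (Φ₁ f) (Φ₂ f))
  have hM₂ := ENNReal.toReal_mono hmax (le_max_right (Φ₁ f) (Φ₂ f))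
  rw [← sub_le_iff_le_add']
  refine le_betaComb_mul hs ENNReal.toReal_nonneg fun a b ha hb hab => ?_
  rw [sub_le_iff_le_add', ← hab]
  calc ‖f‖ ^ 2 ≤ a * ⟪f - T₁ f, f⟫ + β₁ a * (Φ₁ f).toReal := h1 f hf a ha hΦ₁
    _ ≤ a * (b * ⟪f - T₂ f, f⟫ + β₂ b * (max (Φ₁ f) (Φ₂ f)).toReal)
        + β₁ a * (max (Φ₁ f) (Φ₂ f)).toReal := by
      have := hβ₁pos a ha
      have := hβ₂pos b hb
      gcongr
      exact (h2 f hf b hb hΦ₂).trans (by gcongr)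
    _ = a * b * ⟪f - T₂ f, f⟫
        + (a * β₂ b + β₁ a) * (max (Φ₁ f) (Φ₂ f)).toReal := by ring
end

section
/- Let β₁, β₂ : (0,∞) → (0,∞) be decreasing with β₁(s), β₂(s) → 0 as s → ∞, and define β(s) := inf{ s₁·β₂(s₂) + β₁(s₁) : s₁ > 0, s₂ > 0, s₁s₂ = s }. Writing K_i(u) := u·β_i(1/u), K(u) := u·β(1/u) for u > 0 (with value 0 at u = 0) and K_i*, K* for their convex conjugates, it holds that K(u) = inf{ K₂(u₂) + u₂·K₁(u₁) : u₁ > 0, u₂ > 0, u₁u₂ = u } and K*(v) = K₂*(K₁*(v)) for all v ≥ 0. -/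
open MeasureTheory Filter
open scoped ENNReal NNReal

/-- The convex conjugate `K*(v) := sup_{u ≥ 0} (u·v − K(u))`, viewed as a map `[0,∞] → [0,∞]`. -/
noncomputable def KstarE (β : ℝ → ℝ) (v : ℝ≥0∞) : ℝ≥0∞ :=
  ⨆ u : ℝ≥0, ((u : ℝ≥0∞) * v - ENNReal.ofReal (Kfun β (u : ℝ)))

theorem Kfun_of_pos (β : ℝ → ℝ) {u : ℝ} (hu : 0 < u) : Kfun β u = u * β u⁻¹ :=
  if_neg hu.ne'

theorem Kfun_pos {β : ℝ → ℝ} (hβ : ∀ s : ℝ, 0 < s → 0 < β s) {u : ℝ} (hu : 0 < u) :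
    0 < Kfun β u := by
  rw [Kfun_of_pos β hu]
  exact mul_pos hu (hβ _ (inv_pos.2 hu))

theorem Kfun_betaComb (β₁ β₂ : ℝ → ℝ) {u : ℝ} (hu : 0 < u) :
    Kfun (betaComb β₁ β₂) u =
      sInf {z : ℝ | ∃ u₁ u₂ : ℝ, 0 < u₁ ∧ 0 < u₂ ∧ u₁ * u₂ = u ∧
        z = Kfun β₂ u₂ + u₂ * Kfun β₁ u₁} := by
  rw [Kfun_of_pos _ hu, betaComb, ← smul_eq_mul, ← Real.sInf_smul_of_nonneg hu.le]
  congr 1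
  ext z
  simp only [Set.mem_smul_set, Set.mem_ofPred_eq, smul_eq_mul]
  constructor
  · rintro ⟨_, ⟨s₁, s₂, h₁, h₂, hs, rfl⟩, rfl⟩
    have hu' : u = s₁⁻¹ * s₂⁻¹ := by rw [← mul_inv, hs, inv_inv]
    refine ⟨s₁⁻¹, s₂⁻¹, inv_pos.2 h₁, inv_pos.2 h₂, hu'.symm, ?_⟩
    rw [Kfun_of_pos _ (inv_pos.2 h₁), Kfun_of_pos _ (inv_pos.2 h₂), inv_inv, inv_inv, hu']
    field_simp
  · rintro ⟨u₁, u₂, h₁, h₂, rfl, rfl⟩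
    refine ⟨_, ⟨u₁⁻¹, u₂⁻¹, inv_pos.2 h₁, inv_pos.2 h₂, (mul_inv _ _).symm, rfl⟩, ?_⟩
    rw [Kfun_of_pos _ h₁, Kfun_of_pos _ h₂]
    field_simp

/-- Young's inequality for `K` and its conjugate. -/
theorem mul_le_KstarE_add (β : ℝ → ℝ) (u : ℝ≥0) (v : ℝ≥0∞) :
    u * v ≤ KstarE β v + ENNReal.ofReal (Kfun β u) :=
  tsub_le_iff_right.1
    (le_iSup (fun u : ℝ≥0 => (u : ℝ≥0∞) * v - ENNReal.ofReal (Kfun β (u : ℝ))) u)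

theorem ENNReal.le_ofReal_sInf {S : Set ℝ} (hS : S.Nonempty) (h0 : ∀ z ∈ S, 0 ≤ z) {x : ℝ≥0∞}
    (h : ∀ z ∈ S, x ≤ ENNReal.ofReal z) : x ≤ ENNReal.ofReal (sInf S) := by
  obtain ⟨z, hz⟩ := hS
  rw [← ENNReal.ofReal_toReal (ne_top_of_le_ne_top ENNReal.ofReal_ne_top (h z hz))]
  exact ENNReal.ofReal_le_ofReal
    (le_csInf ⟨z, hz⟩ fun y hy => ENNReal.toReal_le_of_le_ofReal (h0 y hy) (h y hy))

theorem ofReal_Kfun_add_mul {β₁ β₂ : ℝ → ℝ} (hβ₁ : ∀ s : ℝ, 0 < s → 0 < β₁ s)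
    (hβ₂ : ∀ s : ℝ, 0 < s → 0 < β₂ s) {u₁ u₂ : ℝ≥0} (h₁ : 0 < u₁) (h₂ : 0 < u₂) :
    ENNReal.ofReal (Kfun β₂ u₂ + u₂ * Kfun β₁ u₁) =
      ENNReal.ofReal (Kfun β₂ u₂) + u₂ * ENNReal.ofReal (Kfun β₁ u₁) := by
  have h₁' : (0 : ℝ) < u₁ := h₁
  have h₂' : (0 : ℝ) < u₂ := h₂
  rw [ENNReal.ofReal_add (Kfun_pos hβ₂ h₂').le (mul_pos h₂' (Kfun_pos hβ₁ h₁')).le,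
    ENNReal.ofReal_mul h₂'.le, ENNReal.ofReal_coe_nnreal]

theorem KstarE_betaComb_le {β₁ β₂ : ℝ → ℝ} (hβ₁ : ∀ s : ℝ, 0 < s → 0 < β₁ s)
    (hβ₂ : ∀ s : ℝ, 0 < s → 0 < β₂ s) (v : ℝ≥0∞) :
    KstarE (betaComb β₁ β₂) v ≤ KstarE β₂ (KstarE β₁ v) := by
  refine iSup_le fun u => ?_
  rcases eq_zero_or_pos u with rfl | hu
  · simp
  have hu' : (0 : ℝ) < u := hu
  rw [tsub_le_iff_left, ← tsub_le_iff_right, Kfun_betaComb β₁ β₂ hu']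
  apply ENNReal.le_ofReal_sInf
  · exact ⟨_, u, 1, hu', one_pos, mul_one _, rfl⟩
  · rintro _ ⟨u₁, u₂, h₁, h₂, -, rfl⟩
    have := Kfun_pos hβ₁ h₁
    have := Kfun_pos hβ₂ h₂
    positivity
  · rintro _ ⟨u₁, u₂, h₁, h₂, h, rfl⟩
    lift u₁ to ℝ≥0 using h₁.le
    lift u₂ to ℝ≥0 using h₂.le
    obtain rfl : u₁ * u₂ = u := by exact_mod_cast h
    rw [ofReal_Kfun_add_mul hβ₁ hβ₂ h₁ h₂, tsub_le_iff_left]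
    calc ((u₁ * u₂ : ℝ≥0) : ℝ≥0∞) * v = u₂ * (u₁ * v) := by push_cast; ring
      _ ≤ u₂ * (KstarE β₁ v + ENNReal.ofReal (Kfun β₁ u₁)) := by
        gcongr
        exact mul_le_KstarE_add β₁ u₁ v
      _ = u₂ * KstarE β₁ v + u₂ * ENNReal.ofReal (Kfun β₁ u₁) := mul_add _ _ _
      _ ≤ KstarE β₂ (KstarE β₁ v) + ENNReal.ofReal (Kfun β₂ u₂) +
          u₂ * ENNReal.ofReal (Kfun β₁ u₁) := by
        gcongr
        exact mul_le_KstarE_add β₂ u₂ _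
      _ = _ := add_assoc _ _ _

theorem KstarE_KstarE_le {β₁ β₂ : ℝ → ℝ} (hβ₁ : ∀ s : ℝ, 0 < s → 0 < β₁ s)
    (hβ₂ : ∀ s : ℝ, 0 < s → 0 < β₂ s) (v : ℝ≥0∞) :
    KstarE β₂ (KstarE β₁ v) ≤ KstarE (betaComb β₁ β₂) v := by
  refine iSup_le fun u₂ => ?_
  rw [tsub_le_iff_right, KstarE, ENNReal.mul_iSup]
  refine iSup_le fun u₁ => ?_
  rcases eq_zero_or_pos u₁ with rfl | h₁
  · simp
  rcases eq_zero_or_pos u₂ with rfl | h₂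
  · simp
  rw [ENNReal.mul_sub fun _ _ => ENNReal.coe_ne_top, tsub_le_iff_right, add_assoc,
    ← ofReal_Kfun_add_mul hβ₁ hβ₂ h₁ h₂]
  calc (u₂ : ℝ≥0∞) * (u₁ * v) = ((u₁ * u₂ : ℝ≥0) : ℝ≥0∞) * v := by push_cast; ring
    _ ≤ KstarE (betaComb β₁ β₂) v +
        ENNReal.ofReal (Kfun (betaComb β₁ β₂) (u₁ * u₂ : ℝ≥0)) := mul_le_KstarE_add _ _ _
    _ ≤ _ := by
      gcongr
      rw [Kfun_betaComb β₁ β₂ (NNReal.coe_pos.2 (mul_pos h₁ h₂))]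
      refine csInf_le ⟨0, ?_⟩ ⟨u₁, u₂, h₁, h₂, (NNReal.coe_mul _ _).symm, rfl⟩
      rintro _ ⟨w₁, w₂, hw₁, hw₂, -, rfl⟩
      have := Kfun_pos hβ₁ hw₁
      have := Kfun_pos hβ₂ hw₂
      positivity

/-- Proposition (chaining at the level of `K` and `K*`): for the chained function `β`,
`K(u) = inf { K₂(u₂) + u₂K₁(u₁) : u₁u₂ = u }` and `K* = K₂* ∘ K₁*`. -/
theorem stmt12 (β₁ β₂ : ℝ → ℝ)
    (hβ₁pos : ∀ s : ℝ, 0 < s → 0 < β₁ s) (hβ₂pos : ∀ s : ℝ, 0 < s → 0 < β₂ s)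
    (hβ₁dec : AntitoneOn β₁ (Set.Ioi 0)) (hβ₂dec : AntitoneOn β₂ (Set.Ioi 0))
    (hβ₁lim : Tendsto β₁ atTop (nhds 0)) (hβ₂lim : Tendsto β₂ atTop (nhds 0)) :
    (∀ u : ℝ, 0 < u →
      Kfun (betaComb β₁ β₂) u =
        sInf {z : ℝ | ∃ u₁ u₂ : ℝ, 0 < u₁ ∧ 0 < u₂ ∧ u₁ * u₂ = u ∧
          z = Kfun β₂ u₂ + u₂ * Kfun β₁ u₁}) ∧
    ∀ v : ℝ, 0 ≤ v →
      KstarE (betaComb β₁ β₂) (ENNReal.ofReal v) = KstarE β₂ (KstarE β₁ (ENNReal.ofReal v)) := by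
  exact ⟨fun _ hu => Kfun_betaComb β₁ β₂ hu, fun _ _ =>
    le_antisymm (KstarE_betaComb_le hβ₁pos hβ₂pos _) (KstarE_KstarE_le hβ₁pos hβ₂pos _)⟩
end

section
/- Let c₁, c₂, α₁, α₂ > 0 and define β₁(s) := c₁·s^{−α₁}, β₂(s) := c₂·s^{−α₂}, and β(s) := inf{ s₁·β₂(s₂) + β₁(s₁) : s₁ > 0, s₂ > 0, s₁s₂ = s }. Then there exists a constant C = C(c₁,c₂,α₁,α₂) > 0 such that for all s > 0, β(s) = C·s^{−α*} with α* := α₁α₂/(1 + α₁ + α₂). -/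
open Filter

open scoped Pointwise

/-- The values `s₁ * β₂ s₂ + β₁ s₁` over all factorizations `s₁ * s₂ = s`, for power-law `β`s. -/
def chainValues (c₁ c₂ α₁ α₂ s : ℝ) : Set ℝ :=
  {y : ℝ | ∃ s₁ s₂ : ℝ, 0 < s₁ ∧ 0 < s₂ ∧ s₁ * s₂ = s ∧
    y = s₁ * (c₂ * s₂ ^ (-α₂)) + c₁ * s₁ ^ (-α₁)}

lemma min_le_of_mem_chainValues_one {c₁ c₂ α₁ α₂ y : ℝ} (hc₁ : 0 < c₁) (hc₂ : 0 < c₂)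
    (hα₁ : 0 ≤ α₁) (hα₂ : 0 ≤ α₂) (hy : y ∈ chainValues c₁ c₂ α₁ α₂ 1) : min c₁ c₂ ≤ y := by
  obtain ⟨t, u, ht, hu, htu, rfl⟩ := hy
  rcases le_total t 1 with h | h
  · have h1 : 1 ≤ t ^ (-α₁) := Real.one_le_rpow_of_pos_of_le_one_of_nonpos ht h (by linarith)
    have h2 : 0 < t * (c₂ * u ^ (-α₂)) := by positivity
    exact (min_le_left _ _).trans (by nlinarith)
  · have h0 : u ≤ 1 := by nlinarith
    have h1 : 1 ≤ u ^ (-α₂) := Real.one_le_rpow_of_pos_of_le_one_of_nonpos hu h0 (by linarith)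
    have h2 : 0 < c₁ * t ^ (-α₁) := by positivity
    have h3 : c₂ ≤ c₂ * u ^ (-α₂) := by nlinarith
    exact (min_le_right _ _).trans (by nlinarith)

/-- The rescaling `(t, u) ↦ (s ^ p * t, s ^ (1 - p) * u)` with `p = α₂ / (1 + α₁ + α₂)`
multiplies both summands by the same power of `s`. -/
lemma chain_rescale (c₁ c₂ : ℝ) {α₁ α₂ s t u : ℝ} (hD : 1 + α₁ + α₂ ≠ 0)
    (hs : 0 < s) (ht : 0 < t) (hu : 0 < u) :
    (s ^ (α₂ / (1 + α₁ + α₂)) * t) * (c₂ * (s ^ (1 - α₂ / (1 + α₁ + α₂)) * u) ^ (-α₂))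
        + c₁ * (s ^ (α₂ / (1 + α₁ + α₂)) * t) ^ (-α₁)
      = s ^ (-(α₁ * α₂ / (1 + α₁ + α₂))) * (t * (c₂ * u ^ (-α₂)) + c₁ * t ^ (-α₁)) := by
  have h1 : s ^ (-(α₁ * α₂ / (1 + α₁ + α₂))) =
      s ^ (α₂ / (1 + α₁ + α₂)) * s ^ ((1 - α₂ / (1 + α₁ + α₂)) * -α₂) := by
    rw [← Real.rpow_add hs]
    congr 1
    field_simp
    ring
  have h2 : s ^ (α₂ / (1 + α₁ + α₂) * -α₁) = s ^ (-(α₁ * α₂ / (1 + α₁ + α₂))) := by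
    congr 1
    ring
  rw [Real.mul_rpow (by positivity) hu.le, Real.mul_rpow (by positivity) ht.le,
    ← Real.rpow_mul hs.le, ← Real.rpow_mul hs.le, h2, h1]
  ring

lemma chainValues_eq_smul (c₁ c₂ : ℝ) {α₁ α₂ s : ℝ} (hD : 1 + α₁ + α₂ ≠ 0) (hs : 0 < s) :
    chainValues c₁ c₂ α₁ α₂ s =
      s ^ (-(α₁ * α₂ / (1 + α₁ + α₂))) • chainValues c₁ c₂ α₁ α₂ 1 := by
  have hp := Real.rpow_pos_of_pos hs (α₂ / (1 + α₁ + α₂))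
  have hq := Real.rpow_pos_of_pos hs (1 - α₂ / (1 + α₁ + α₂))
  have hpq : s ^ (α₂ / (1 + α₁ + α₂)) * s ^ (1 - α₂ / (1 + α₁ + α₂)) = s := by
    rw [← Real.rpow_add hs, add_sub_cancel, Real.rpow_one]
  ext y
  rw [Set.mem_smul_set]
  constructor
  · rintro ⟨t, u, ht, hu, htu, rfl⟩
    refine ⟨_, ⟨t / s ^ (α₂ / (1 + α₁ + α₂)), u / s ^ (1 - α₂ / (1 + α₁ + α₂)),
      div_pos ht hp, div_pos hu hq, ?_, rfl⟩, ?_⟩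
    · rw [div_mul_div_comm, hpq, htu, div_self hs.ne']
    · rw [smul_eq_mul, ← chain_rescale c₁ c₂ hD hs (div_pos ht hp) (div_pos hu hq),
        mul_div_cancel₀ _ hp.ne', mul_div_cancel₀ _ hq.ne']
  · rintro ⟨_, ⟨t, u, ht, hu, htu, rfl⟩, rfl⟩
    refine ⟨_, _, mul_pos hp ht, mul_pos hq hu, ?_, (chain_rescale c₁ c₂ hD hs ht hu).symm⟩
    rw [mul_mul_mul_comm, hpq, htu, mul_one]

/-- Example (chaining two polynomially decaying `β`s): with `β₁(s) = c₁ s^{-α₁}` and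
`β₂(s) = c₂ s^{-α₂}`, the chained function satisfies `β(s) = C·s^{-α*}` with
`α* = α₁α₂/(1+α₁+α₂)`. -/
theorem stmt13 (c₁ c₂ α₁ α₂ : ℝ) (hc₁ : 0 < c₁) (hc₂ : 0 < c₂)
    (hα₁ : 0 < α₁) (hα₂ : 0 < α₂)
    (β₁ β₂ β : ℝ → ℝ)
    (hβ₁ : β₁ = fun s : ℝ => c₁ * s ^ (-α₁))
    (hβ₂ : β₂ = fun s : ℝ => c₂ * s ^ (-α₂))
    (hβ : ∀ s : ℝ, β s =
      sInf {y : ℝ | ∃ s₁ s₂ : ℝ, 0 < s₁ ∧ 0 < s₂ ∧ s₁ * s₂ = s ∧ y = s₁ * β₂ s₂ + β₁ s₁}) :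
    ∃ C : ℝ, 0 < C ∧ ∀ s : ℝ, 0 < s → β s = C * s ^ (-(α₁ * α₂ / (1 + α₁ + α₂))) := by
  subst hβ₁ hβ₂
  change ∀ s, β s = sInf (chainValues c₁ c₂ α₁ α₂ s) at hβ
  have hne : (chainValues c₁ c₂ α₁ α₂ 1).Nonempty :=
    ⟨_, 1, 1, one_pos, one_pos, one_mul 1, rfl⟩
  refine ⟨sInf (chainValues c₁ c₂ α₁ α₂ 1), (lt_min hc₁ hc₂).trans_le (le_csInf hne fun y hy =>
    min_le_of_mem_chainValues_one hc₁ hc₂ hα₁.le hα₂.le hy), fun s hs => ?_⟩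
  rw [hβ, chainValues_eq_smul c₁ c₂ (by positivity) hs,
    Real.sInf_smul_of_nonneg (by positivity), smul_eq_mul, mul_comm]
end

section
/- Let (E,ℱ) be a standard Borel space, μ a probability measure, and P₁, P₂ Markov kernels on E, both leaving μ invariant. Assume there is a measurable ε : E×E → (0,∞) such that P₂(x, A∖{x}) ≥ ∫_{A∖{x}} ε(x,y) P₁(x,dy) for all x ∈ E and A ∈ ℱ. Then for any p ∈ (1,∞), q ≥ 1 with 1/p + 1/q = 1, any s > 0, and any f ∈ L^{2p}(μ): (1/2)∬ μ(dx)P₁(x,dy)(f(y)−f(x))² ≤ s·(1/2)∬ μ(dx)P₂(x,dy)(f(y)−f(x))² + ((μ⊗P₁)(A(s)ᶜ ∩ {(x,y) : x ≠ y}))^{1/q} · 4‖f‖_{2p}², where A(s) := {(x,y) ∈ E×E : s·ε(x,y) > 1}. -/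
open MeasureTheory ProbabilityTheory Filter
open scoped ENNReal

/-- If a measure `ν` dominates `ρ` with density `w` away from `x`, then it does so on nonnegative
functions vanishing at `x`. -/
lemma lintegral_density_mul_le_of_apply_eq_zero {E : Type*} [MeasurableSpace E]
    [MeasurableSingletonClass E] {ρ ν : Measure E} {w g : E → ℝ≥0∞} {x : E}
    (hw : Measurable w) (hg : Measurable g) (hgx : g x = 0)
    (h : ∀ A : Set E, MeasurableSet A → ∫⁻ y in A \ {x}, w y ∂ρ ≤ ν (A \ {x})) :
    ∫⁻ y, w y * g y ∂ρ ≤ ∫⁻ y, g y ∂ν := by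
  have hle : (ρ.restrict {x}ᶜ).withDensity w ≤ ν := by
    refine Measure.le_iff.2 fun A hA => ?_
    rw [withDensity_apply _ hA, Measure.restrict_restrict hA, ← Set.sdiff_eq]
    exact (h A hA).trans (measure_mono Set.sdiff_subset)
  calc ∫⁻ y, w y * g y ∂ρ = ∫⁻ y in {x}ᶜ, w y * g y ∂ρ := by
        rw [← lintegral_indicator (measurableSet_singleton x).compl]
        congr with y
        by_cases hy : y = x <;> simp [hy, hgx]
    _ = ∫⁻ y, g y ∂(ρ.restrict {x}ᶜ).withDensity w :=
        (lintegral_withDensity_eq_lintegral_mul _ hw hg).symm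
    _ ≤ ∫⁻ y, g y ∂ν := lintegral_mono' hle le_rfl

/-- The increment of an `L^r` function along a stationary transition is in `L^r`, with norm at most
twice that of the function. -/
lemma memLp_increment_compProd {E : Type*} [MeasurableSpace E] {μ : Measure E}
    [IsProbabilityMeasure μ] {P : Kernel E E} [IsMarkovKernel P] (hinv : μ.bind P = μ)
    {f : E → ℝ} {r : ℝ≥0∞} (hr : 1 ≤ r) (hf : MemLp f r μ) :
    MemLp (fun z : E × E => f z.2 - f z.1) r (μ.compProd P) ∧
      eLpNorm (fun z : E × E => f z.2 - f z.1) r (μ.compProd P) ≤ 2 * eLpNorm f r μ := by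
  have h₁ : MeasurePreserving Prod.fst (μ.compProd P) μ :=
    ⟨measurable_fst, Measure.fst_compProd μ P⟩
  have h₂ : MeasurePreserving Prod.snd (μ.compProd P) μ :=
    ⟨measurable_snd, (Measure.snd_compProd μ P).trans hinv⟩
  have m₁ := hf.comp_measurePreserving h₁
  have m₂ := hf.comp_measurePreserving h₂
  refine ⟨m₂.sub m₁, (eLpNorm_sub_le m₂.1 m₁.1 hr).trans_eq ?_⟩
  rw [eLpNorm_comp_measurePreserving hf.1 h₁, eLpNorm_comp_measurePreserving hf.1 h₂, two_mul]

/-- Hölder's inequality for the square of a function on a set. -/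
lemma setLIntegral_enorm_sq_le {α : Type*} [MeasurableSpace α] {ν : Measure α} {h : α → ℝ}
    {p q : ℝ} (hpq : p.HolderConjugate q) (hh : AEStronglyMeasurable h ν) (B : Set α) :
    ∫⁻ z in B, ‖h z‖ₑ ^ 2 ∂ν ≤
      ν B ^ (1 / q) * eLpNorm h (ENNReal.ofReal (2 * p)) ν ^ 2 := by
  have hp := hpq.lt
  have h2 : (2 : ℝ≥0∞) ≤ ENNReal.ofReal (2 * p) := by
    rw [← ENNReal.ofReal_ofNat]
    exact ENNReal.ofReal_le_ofReal (by linarith)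
  have key := eLpNorm_le_eLpNorm_mul_rpow_measure_univ h2 (hh.restrict (s := B))
  have hsq : ∫⁻ z in B, ‖h z‖ₑ ^ 2 ∂ν = eLpNorm h 2 (ν.restrict B) ^ 2 := by
    rw [eLpNorm_eq_lintegral_rpow_enorm_toReal (by norm_num) (by norm_num), ← ENNReal.rpow_natCast,
      ← ENNReal.rpow_mul]
    simp
  have hexp : (1 / ENNReal.toReal 2 - 1 / (ENNReal.ofReal (2 * p)).toReal) * ((2 : ℕ) : ℝ)
      = 1 / q := by
    rw [ENNReal.toReal_ofReal (by linarith), ENNReal.toReal_ofNat]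
    have := hpq.inv_add_inv_eq_one
    have hp0 : p ≠ 0 := by linarith
    rw [one_div q, ← sub_eq_of_eq_add' this.symm]
    push_cast
    field_simp
  rw [hsq]
  refine (pow_le_pow_left' key 2).trans ?_
  rw [mul_pow, ← ENNReal.rpow_natCast (_ ^ (_ : ℝ)), ← ENNReal.rpow_mul, hexp,
    Measure.restrict_apply_univ, mul_comm]
  gcongr
  exact Measure.restrict_le_self

/-- Theorem (practical comparison of two `μ`-invariant Markov kernels): if
`P₂(x, A∖{x}) ≥ ∫_{A∖{x}} ε(x,y) P₁(x,dy)` then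
`E(P₁,f) ≤ s·E(P₂,f) + (μ⊗P₁)(A(s)ᶜ ∩ {x ≠ y})^{1/q}·4‖f‖_{2p}²`. -/
theorem stmt15 {E : Type*} [MeasurableSpace E] [StandardBorelSpace E]
    (μ : Measure E) [IsProbabilityMeasure μ]
    (P₁ P₂ : Kernel E E) [IsMarkovKernel P₁] [IsMarkovKernel P₂]
    (hinv₁ : μ.bind (fun x => P₁ x) = μ) (hinv₂ : μ.bind (fun x => P₂ x) = μ)
    (ε : E × E → ℝ) (hεm : Measurable ε) (hεpos : ∀ z : E × E, 0 < ε z)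
    (hmin : ∀ (x : E) (A : Set E), MeasurableSet A →
      ∫⁻ y in A \ {x}, ENNReal.ofReal (ε (x, y)) ∂(P₁ x) ≤ P₂ x (A \ {x}))
    (p q : ℝ) (hp : 1 < p) (hq : 1 ≤ q) (hpq : 1 / p + 1 / q = 1)
    (f : E → ℝ) (hf : Measurable f)
    (hfLp : Integrable (fun x => |f x| ^ (2 * p)) μ)
    (s : ℝ) (hs : 0 < s) :
    (1 / 2) * ∫ z, (f z.2 - f z.1) ^ 2 ∂(μ.compProd P₁) ≤
      s * ((1 / 2) * ∫ z, (f z.2 - f z.1) ^ 2 ∂(μ.compProd P₂)) +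
      ((μ.compProd P₁) ({z : E × E | 1 < s * ε z}ᶜ ∩ {z : E × E | z.1 ≠ z.2})).toReal ^ (1 / q) *
        (4 * ((∫ x, |f x| ^ (2 * p) ∂μ) ^ (1 / (2 * p))) ^ 2) := by
  have hconj : p.HolderConjugate q :=
    Real.holderConjugate_iff.2 ⟨hp, by simpa only [one_div] using hpq⟩
  set h : E × E → ℝ := fun z => f z.2 - f z.1 with h_def
  have hm : Measurable h := (hf.comp measurable_snd).sub (hf.comp measurable_fst)
  have hGm : Measurable fun z => ‖h z‖ₑ ^ 2 := hm.enorm.pow_const 2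
  have hεGm : Measurable fun z => ENNReal.ofReal (ε z) * ‖h z‖ₑ ^ 2 :=
    hεm.ennreal_ofReal.mul hGm
  set r : ℝ≥0∞ := ENNReal.ofReal (2 * p) with r_def
  have hr2 : 2 ≤ r := by
    rw [r_def, ← ENNReal.ofReal_ofNat]
    exact ENNReal.ofReal_le_ofReal (by linarith)
  have hr1 : 1 ≤ r := one_le_two.trans hr2
  have hr0 : r ≠ 0 := (zero_lt_one.trans_le hr1).ne'
  have hrt : r.toReal = 2 * p := ENNReal.toReal_ofReal (by linarith)
  have hfr : MemLp f r μ := by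
    rw [← integrable_norm_rpow_iff hf.aestronglyMeasurable hr0 ENNReal.ofReal_ne_top, hrt]
    exact hfLp
  have hN : eLpNorm f r μ = ENNReal.ofReal ((∫ x, |f x| ^ (2 * p) ∂μ) ^ (1 / (2 * p))) := by
    rw [hfr.eLpNorm_eq_integral_rpow_norm hr0 ENNReal.ofReal_ne_top, hrt, one_div]
    rfl
  obtain ⟨-, b₁⟩ := memLp_increment_compProd hinv₁ hr1 hfr
  obtain ⟨m₂, -⟩ := memLp_increment_compProd hinv₂ hr1 hfr
  have integral_sq_eq : ∀ ν : Measure (E × E), ∫ z, h z ^ 2 ∂ν = (∫⁻ z, ‖h z‖ₑ ^ 2 ∂ν).toReal := by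
    intro ν
    rw [integral_eq_lintegral_of_nonneg_ae (ae_of_all _ fun z => sq_nonneg _)
      (hm.pow_const 2).aestronglyMeasurable]
    congr 2 with z
    rw [← enorm_pow, Real.enorm_of_nonneg (sq_nonneg _)]
  have hfin : ∫⁻ z, ‖h z‖ₑ ^ 2 ∂(μ.compProd P₂) ≠ ∞ := by
    have := setLIntegral_enorm_sq_le hconj hm.aestronglyMeasurable (ν := μ.compProd P₂) Set.univ
    rw [Measure.restrict_univ, measure_univ, ENNReal.one_rpow, one_mul] at this
    exact (this.trans_lt (ENNReal.pow_lt_top m₂.2)).ne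
  have hdom : ∫⁻ z, ENNReal.ofReal (ε z) * ‖h z‖ₑ ^ 2 ∂(μ.compProd P₁) ≤
      ∫⁻ z, ‖h z‖ₑ ^ 2 ∂(μ.compProd P₂) := by
    rw [Measure.lintegral_compProd hεGm, Measure.lintegral_compProd hGm]
    refine lintegral_mono fun x => ?_
    exact lintegral_density_mul_le_of_apply_eq_zero
      (hεm.ennreal_ofReal.comp measurable_prodMk_left) (hGm.comp measurable_prodMk_left)
      (by simp [h_def]) (hmin x)
  set B : Set (E × E) := {z : E × E | 1 < s * ε z}ᶜ ∩ {z : E × E | z.1 ≠ z.2} with B_def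
  have hBm : MeasurableSet B :=
    (measurableSet_lt measurable_const (hεm.const_mul s)).compl.inter
      (measurableSet_eq_fun measurable_fst measurable_snd).compl
  have hsplit : ∫⁻ z, ‖h z‖ₑ ^ 2 ∂(μ.compProd P₁) ≤
      ENNReal.ofReal s * ∫⁻ z, ‖h z‖ₑ ^ 2 ∂(μ.compProd P₂) +
        ∫⁻ z in B, ‖h z‖ₑ ^ 2 ∂(μ.compProd P₁) := by
    rw [← lintegral_add_compl _ hBm, add_comm]
    gcongr
    refine le_trans ?_ (mul_le_mul_right hdom _)
    rw [← lintegral_const_mul _ hεGm]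
    refine (setLIntegral_mono (by fun_prop) fun z hz => ?_).trans (setLIntegral_le_lintegral _ _)
    rw [← mul_assoc, ← ENNReal.ofReal_mul hs.le]
    by_cases hz' : z.1 = z.2
    · simp [h_def, hz']
    · have hA : 1 < s * ε z := by
        by_contra hA
        exact hz ⟨hA, hz'⟩
      exact le_mul_of_one_le_left' (ENNReal.one_le_ofReal.2 hA.le)
  set N : ℝ := (∫ x, |f x| ^ (2 * p) ∂μ) ^ (1 / (2 * p)) with N_def
  have hN0 : 0 ≤ N := Real.rpow_nonneg (integral_nonneg fun x => by positivity) _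
  have hB : ∫⁻ z in B, ‖h z‖ₑ ^ 2 ∂(μ.compProd P₁) ≤
      (μ.compProd P₁) B ^ (1 / q) * (2 * ENNReal.ofReal N) ^ 2 := by
    refine (setLIntegral_enorm_sq_le hconj hm.aestronglyMeasurable B).trans ?_
    rw [← hN]
    gcongr
  have hBfin : (μ.compProd P₁) B ^ (1 / q) * (2 * ENNReal.ofReal N) ^ 2 ≠ ∞ :=
    ENNReal.mul_ne_top (ENNReal.rpow_ne_top_of_nonneg (by positivity) (measure_ne_top _ _))
      (ENNReal.pow_ne_top (ENNReal.mul_ne_top (by norm_num) ENNReal.ofReal_ne_top))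
  have hsfin := ENNReal.mul_ne_top (ENNReal.ofReal_ne_top (r := s)) hfin
  have hreal := ENNReal.toReal_mono (ENNReal.add_ne_top.2 ⟨hsfin, hBfin⟩)
    (hsplit.trans (add_le_add_right hB _))
  rw [ENNReal.toReal_add hsfin hBfin, ENNReal.toReal_mul, ENNReal.toReal_mul, ENNReal.toReal_pow,
    ENNReal.toReal_mul, ENNReal.toReal_ofReal hs.le, ENNReal.toReal_ofReal hN0,
    ENNReal.toReal_ofNat, ← ENNReal.toReal_rpow, ← integral_sq_eq, ← integral_sq_eq] at hreal
  have hpos : 0 ≤ ((μ.compProd P₁) B).toReal ^ (1 / q) * N ^ 2 := by positivity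
  linarith
end

section
/- Let (E,ℱ) be a standard Borel space, μ a probability measure, and P a Markov kernel on E leaving μ invariant. Assume there is a measurable ε : E → [0,1] such that P(x,A) ≥ ε(x)·δ_x(A) for all x ∈ E and A ∈ ℱ. Then: (1) for all x ∈ E and A ∈ ℱ, P²(x,A) ≥ ε(x)·P(x,A), where P² denotes the composition of P with itself; (2) for any p ∈ (1,∞), q ≥ 1 with 1/p + 1/q = 1, any f ∈ L^{2p}(μ) and any s > 0: (1/2)∬ μ(dx)P(x,dy)(f(y)−f(x))² ≤ s·(1/2)∬ μ(dx)P²(x,dy)(f(y)−f(x))² + (μ({x : ε(x) ≤ 1/s}))^{1/q} · 4‖f‖_{2p}². -/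
open MeasureTheory ProbabilityTheory Filter
open scoped ENNReal

section WeaklyLazy

variable {E : Type*} [MeasurableSpace E]

theorem ofReal_mul_le_comp_self (P : Kernel E E) (ε : E → ℝ)
    (hmin : ∀ (x : E) (A : Set E), MeasurableSet A →
      ENNReal.ofReal (ε x) * Measure.dirac x A ≤ P x A)
    (x : E) {A : Set E} (hA : MeasurableSet A) :
    ENNReal.ofReal (ε x) * P x A ≤ (P ∘ₖ P) x A := by
  have hle : ENNReal.ofReal (ε x) • Measure.dirac x ≤ P x :=
    Measure.le_iff.2 fun B hB => by simpa using hmin x B hB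
  rw [Kernel.comp_apply' _ _ _ hA]
  calc ENNReal.ofReal (ε x) * P x A
      = ∫⁻ y, P y A ∂(ENNReal.ofReal (ε x) • Measure.dirac x) := by
        rw [lintegral_smul_measure, lintegral_dirac' _ (P.measurable_coe hA), smul_eq_mul]
    _ ≤ ∫⁻ y, P y A ∂(P x) := lintegral_mono' hle le_rfl

theorem restrict_compProd_le_smul_compProd (μ : Measure E) [SFinite μ] (P Q : Kernel E E)
    [IsSFiniteKernel P] [IsSFiniteKernel Q] (ε : E → ℝ) (hεm : Measurable ε)
    (hPQ : ∀ (x : E) (A : Set E), MeasurableSet A → ENNReal.ofReal (ε x) * P x A ≤ Q x A)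
    {s : ℝ} (hs : 0 < s) :
    (μ.compProd P).restrict (Prod.fst ⁻¹' {x : E | ε x ≤ 1 / s})ᶜ ≤
      ENNReal.ofReal s • μ.compProd Q := by
  have hB : MeasurableSet (Prod.fst ⁻¹' {x : E | ε x ≤ 1 / s} : Set (E × E)) :=
    measurable_fst (measurableSet_le hεm measurable_const)
  refine Measure.le_iff.2 fun S hS => ?_
  rw [Measure.restrict_apply hS, Measure.smul_apply, smul_eq_mul,
    Measure.compProd_apply (hS.inter hB.compl), Measure.compProd_apply hS,
    ← lintegral_const_mul _ (Kernel.measurable_kernel_prodMk_left hS)]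
  refine lintegral_mono fun x => ?_
  by_cases hx : ε x ≤ 1 / s
  · have hempty : Prod.mk x ⁻¹' (S ∩ (Prod.fst ⁻¹' {x : E | ε x ≤ 1 / s})ᶜ) = ∅ := by
      ext y
      simp only [Set.mem_preimage, Set.mem_inter_iff, Set.mem_compl_iff, Set.mem_ofPred_eq,
        Set.mem_empty_iff_false, iff_false]
      tauto
    simp only [hempty, measure_empty, zero_le]
  · have hone : 1 ≤ ENNReal.ofReal s * ENNReal.ofReal (ε x) := by
      rw [← ENNReal.ofReal_mul hs.le, ENNReal.one_le_ofReal]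
      have := (div_lt_iff₀ hs).1 (not_le.1 hx)
      linarith
    calc P x (Prod.mk x ⁻¹' (S ∩ (Prod.fst ⁻¹' {x : E | ε x ≤ 1 / s})ᶜ))
        ≤ P x (Prod.mk x ⁻¹' S) := measure_mono (Set.preimage_mono Set.inter_subset_left)
      _ ≤ ENNReal.ofReal s * ENNReal.ofReal (ε x) * P x (Prod.mk x ⁻¹' S) :=
        le_mul_of_one_le_left' hone
      _ ≤ ENNReal.ofReal s * Q x (Prod.mk x ⁻¹' S) := by
        rw [mul_assoc]
        gcongr
        exact hPQ x _ (measurable_prodMk_left hS)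

theorem memLp_of_integrable_abs_rpow {μ : Measure E} {f : E → ℝ} (hf : Measurable f) {r : ℝ}
    (hr : 0 < r) (hint : Integrable (fun x => |f x| ^ r) μ) : MemLp f (ENNReal.ofReal r) μ := by
  rw [← integrable_norm_rpow_iff hf.aestronglyMeasurable (by simpa using hr)
    ENNReal.ofReal_ne_top, ENNReal.toReal_ofReal hr.le]
  simpa only [Real.norm_eq_abs] using hint

theorem memLp_two_of_integrable_abs_rpow {μ : Measure E} [IsFiniteMeasure μ] {f : E → ℝ}
    (hf : Measurable f) {p : ℝ} (hp : 1 ≤ p)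
    (hint : Integrable (fun x => |f x| ^ (2 * p)) μ) : MemLp f 2 μ :=
  (memLp_of_integrable_abs_rpow hf (by linarith) hint).mono_exponent (by
    rw [show (2 : ℝ≥0∞) = ENNReal.ofReal 2 by simp]
    exact ENNReal.ofReal_le_ofReal (by linarith))

theorem setIntegral_sq_le_measure_rpow_mul {ρ : Measure E} [IsFiniteMeasure ρ] {p q : ℝ}
    (hpq : p.HolderConjugate q) {h : E → ℝ} (hh : Measurable h)
    (hint : Integrable (fun x => |h x| ^ (2 * p)) ρ) {A : Set E} (hA : MeasurableSet A) :
    ∫ x in A, h x ^ 2 ∂ρ ≤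
      (ρ A).toReal ^ (1 / q) * (∫ x, |h x| ^ (2 * p) ∂ρ) ^ (1 / p) := by
  have hpow : ∀ x, (h x ^ 2) ^ p = |h x| ^ (2 * p) := fun x => by
    rw [← sq_abs, ← Real.rpow_natCast, ← Real.rpow_mul (abs_nonneg _), Nat.cast_ofNat]
  have hsq : MemLp (fun x => h x ^ 2) (ENNReal.ofReal p) ρ :=
    memLp_of_integrable_abs_rpow (hh.pow_const 2) hpq.pos (by simpa [hpow] using hint)
  have hone : MemLp (A.indicator fun _ => (1 : ℝ)) (ENNReal.ofReal q) ρ :=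
    memLp_indicator_const _ hA _ (Or.inr (measure_ne_top _ _))
  have key := integral_mul_le_Lp_mul_Lq_of_nonneg hpq (ae_of_all ρ fun x => sq_nonneg (h x))
    (ae_of_all ρ fun x => Set.indicator_nonneg (fun _ _ => zero_le_one) x) hsq hone
  have hind : ∀ x, (A.indicator (fun _ => (1 : ℝ)) x) ^ q = A.indicator (fun _ => (1 : ℝ)) x := by
    intro x
    by_cases hx : x ∈ A <;> simp [hx, hpq.symm.ne_zero]
  have hmul : ∀ x, h x ^ 2 * A.indicator (fun _ => (1 : ℝ)) x =
      A.indicator (fun x => h x ^ 2) x := by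
    intro x
    by_cases hx : x ∈ A <;> simp [hx]
  simp only [hpow, hind, hmul, integral_indicator hA, setIntegral_const, smul_eq_mul,
    mul_one] at key
  rwa [mul_comm]

theorem integrable_sq_sub_compProd {μ : Measure E} [SFinite μ] {κ : Kernel E E}
    [IsMarkovKernel κ] (hinv : μ.bind (fun x => κ x) = μ) {f : E → ℝ} (hf : MemLp f 2 μ) :
    Integrable (fun z : E × E => (f z.2 - f z.1) ^ 2) (μ.compProd κ) := by
  have h1 : MeasurePreserving Prod.fst (μ.compProd κ) μ :=
    ⟨measurable_fst, Measure.fst_compProd μ κ⟩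
  have h2 : MeasurePreserving Prod.snd (μ.compProd κ) μ :=
    ⟨measurable_snd, (Measure.snd_compProd μ κ).trans hinv⟩
  exact ((hf.comp_measurePreserving h2).sub (hf.comp_measurePreserving h1)).integrable_sq

theorem setIntegral_sq_sub_compProd_le {μ : Measure E} [IsFiniteMeasure μ] {κ : Kernel E E}
    [IsMarkovKernel κ] (hinv : μ.bind (fun x => κ x) = μ) {p q : ℝ} (hpq : p.HolderConjugate q)
    {f : E → ℝ} (hf : Measurable f) (hint : Integrable (fun x => |f x| ^ (2 * p)) μ)
    {A : Set E} (hA : MeasurableSet A) :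
    ∫ z in Prod.fst ⁻¹' A, (f z.2 - f z.1) ^ 2 ∂(μ.compProd κ) ≤
      (μ A).toReal ^ (1 / q) * (4 * (∫ x, |f x| ^ (2 * p) ∂μ) ^ (1 / p)) := by
  have h1 : MeasurePreserving Prod.fst (μ.compProd κ) μ :=
    ⟨measurable_fst, Measure.fst_compProd μ κ⟩
  have h2 : MeasurePreserving Prod.snd (μ.compProd κ) μ :=
    ⟨measurable_snd, (Measure.snd_compProd μ κ).trans hinv⟩
  have hL2 : MemLp f 2 μ := memLp_two_of_integrable_abs_rpow hf hpq.lt.le hint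
  have hB : MeasurableSet (Prod.fst ⁻¹' A : Set (E × E)) := measurable_fst hA
  have bound : ∀ {g : E × E → E}, MeasurePreserving g (μ.compProd κ) μ →
      ∫ z in Prod.fst ⁻¹' A, f (g z) ^ 2 ∂(μ.compProd κ) ≤
        (μ A).toReal ^ (1 / q) * (∫ x, |f x| ^ (2 * p) ∂μ) ^ (1 / p) := by
    intro g hg
    have key := setIntegral_sq_le_measure_rpow_mul hpq (hf.comp hg.measurable)
      (hg.integrable_comp_of_integrable hint) hB
    have hmap : ∫ z, |f (g z)| ^ (2 * p) ∂(μ.compProd κ) = ∫ x, |f x| ^ (2 * p) ∂μ := by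
      rw [← integral_map (φ := g) (f := fun x => |f x| ^ (2 * p)) hg.measurable.aemeasurable
        (by rw [hg.map_eq]; exact hint.aestronglyMeasurable), hg.map_eq]
    rw [h1.measure_preimage hA.nullMeasurableSet] at key
    simpa only [Function.comp_apply, hmap] using key
  have i1 := (hL2.comp_measurePreserving h1).integrable_sq.integrableOn (s := Prod.fst ⁻¹' A)
  have i2 := (hL2.comp_measurePreserving h2).integrable_sq.integrableOn (s := Prod.fst ⁻¹' A)
  calc ∫ z in Prod.fst ⁻¹' A, (f z.2 - f z.1) ^ 2 ∂(μ.compProd κ)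
      ≤ ∫ z in Prod.fst ⁻¹' A, (2 * f z.2 ^ 2 + 2 * f z.1 ^ 2) ∂(μ.compProd κ) := by
        refine integral_mono (integrable_sq_sub_compProd hinv hL2).integrableOn
          ((i2.const_mul 2).add (i1.const_mul 2)) fun z => ?_
        simp only
        nlinarith [sq_nonneg (f z.2 + f z.1)]
    _ = 2 * ∫ z in Prod.fst ⁻¹' A, f z.2 ^ 2 ∂(μ.compProd κ) +
          2 * ∫ z in Prod.fst ⁻¹' A, f z.1 ^ 2 ∂(μ.compProd κ) := by
        rw [← integral_const_mul, ← integral_const_mul]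
        exact integral_add (i2.const_mul 2) (i1.const_mul 2)
    _ ≤ _ := by linarith [bound h1, bound h2]

end WeaklyLazy

/-- Theorem (weakly lazy chains): if `P(x,·) ≥ ε(x)δ_x`, then `P² ≥ ε·P` pointwise and
`E(P,f) ≤ s·E(P²,f) + μ(ε(X)⁻¹ ≥ s)^{1/q}·4‖f‖_{2p}²`. -/
theorem stmt16 {E : Type*} [MeasurableSpace E] [StandardBorelSpace E]
    (μ : Measure E) [IsProbabilityMeasure μ]
    (P : Kernel E E) [IsMarkovKernel P]
    (hinv : μ.bind (fun x => P x) = μ)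
    (ε : E → ℝ) (hεm : Measurable ε) (hε : ∀ x : E, ε x ∈ Set.Icc (0 : ℝ) 1)
    (hmin : ∀ (x : E) (A : Set E), MeasurableSet A →
      ENNReal.ofReal (ε x) * Measure.dirac x A ≤ P x A) :
    (∀ (x : E) (A : Set E), MeasurableSet A →
      ENNReal.ofReal (ε x) * P x A ≤ (P ∘ₖ P) x A) ∧
    ∀ p q : ℝ, 1 < p → 1 ≤ q → 1 / p + 1 / q = 1 →
      ∀ f : E → ℝ, Measurable f → Integrable (fun x => |f x| ^ (2 * p)) μ →
        ∀ s : ℝ, 0 < s →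
          (1 / 2) * ∫ z, (f z.2 - f z.1) ^ 2 ∂(μ.compProd P) ≤
            s * ((1 / 2) * ∫ z, (f z.2 - f z.1) ^ 2 ∂(μ.compProd (P ∘ₖ P))) +
            (μ {x : E | ε x ≤ 1 / s}).toReal ^ (1 / q) *
              (4 * ((∫ x, |f x| ^ (2 * p) ∂μ) ^ (1 / (2 * p))) ^ 2) := by
  have hsq : ∀ (x : E) (A : Set E), MeasurableSet A →
      ENNReal.ofReal (ε x) * P x A ≤ (P ∘ₖ P) x A :=
    fun x A hA => ofReal_mul_le_comp_self P ε hmin x hA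
  refine ⟨hsq, fun p q hp hq hpq f hf hint s hs => ?_⟩
  have hconj : p.HolderConjugate q := by
    rw [Real.holderConjugate_iff]
    exact ⟨hp, by simpa only [one_div] using hpq⟩
  have hinv2 : μ.bind (fun x => (P ∘ₖ P) x) = μ := by
    change μ.bind ⇑P = μ at hinv
    change μ.bind ⇑(P ∘ₖ P) = μ
    rw [← Measure.comp_assoc, hinv, hinv]
  have hL2 : MemLp f 2 μ := memLp_two_of_integrable_abs_rpow hf hp.le hint
  have hA : MeasurableSet {x : E | ε x ≤ 1 / s} := measurableSet_le hεm measurable_const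
  have hB : MeasurableSet (Prod.fst ⁻¹' {x : E | ε x ≤ 1 / s} : Set (E × E)) := measurable_fst hA
  have hsplit := integral_add_compl hB (integrable_sq_sub_compProd hinv hL2)
  have hsmall := setIntegral_sq_sub_compProd_le hinv hconj hf hint hA
  have hlarge : ∫ z in (Prod.fst ⁻¹' {x : E | ε x ≤ 1 / s})ᶜ, (f z.2 - f z.1) ^ 2 ∂(μ.compProd P) ≤
      s * ∫ z, (f z.2 - f z.1) ^ 2 ∂(μ.compProd (P ∘ₖ P)) := by
    have h := integral_mono_measure
      (restrict_compProd_le_smul_compProd μ P (P ∘ₖ P) ε hεm hsq hs)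
      (ae_of_all _ fun z => sq_nonneg (f z.2 - f z.1))
      ((integrable_sq_sub_compProd hinv2 hL2).smul_measure ENNReal.ofReal_ne_top)
    rwa [integral_smul_measure, ENNReal.toReal_ofReal hs.le, smul_eq_mul] at h
  have hnonneg : 0 ≤ ∫ x, |f x| ^ (2 * p) ∂μ := integral_nonneg fun x => by positivity
  have hnorm : ((∫ x, |f x| ^ (2 * p) ∂μ) ^ (1 / (2 * p))) ^ 2 =
      (∫ x, |f x| ^ (2 * p) ∂μ) ^ (1 / p) := by
    rw [← Real.rpow_natCast, ← Real.rpow_mul hnonneg]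
    congr 1
    push_cast
    field_simp
  rw [hnorm]
  have hpos : 0 ≤ (μ {x : E | ε x ≤ 1 / s}).toReal ^ (1 / q) *
      (4 * (∫ x, |f x| ^ (2 * p) ∂μ) ^ (1 / p)) := by positivity
  linarith
end

section
/- Let X be a standard Borel space, π a probability measure on X, q a Markov kernel on X, and (Q_x)_{x∈X} a measurable family of probability measures on (0,∞) with ∫ w Q_x(dw) = 1 for every x. Set π̃_x(dw) := w·Q_x(dw) and π̃(dx,dw) := π(dx)π̃_x(dw). Let 𝔯 : X×X → [0,∞) be measurable and satisfy π(dx)q(x,dy)·𝔯(x,y) = π(dy)q(y,dx) as measures on X×X. Then for any p ∈ (1,∞), q' ≥ 1 with 1/p + 1/q' = 1, any s > 0, and any measurable f : X×(0,∞) → ℝ with f ∈ L^{2p}(π̃): (1/2)∫ min(1, 𝔯(x,y))·(f(y,u)−f(x,w))² π(dx)π̃_x(dw)q(x,dy)π̃_y(du) ≤ s·(1/2)∫ min(1, 𝔯(x,y)·u/w)·(f(y,u)−f(x,w))² π(dx)π̃_x(dw)q(x,dy)Q_y(du) + 4‖f‖_{L^{2p}(π̃)}² · ( 2∫ π̃_x([s,∞))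 π(dx) )^{1/q'}. -/
open MeasureTheory ProbabilityTheory Filter
open scoped ENNReal

namespace PseudoMarginal

variable {X W : Type*} [MeasurableSpace X] [MeasurableSpace W]

/-- The density of a reversed measure is inverse to its own reversal, almost everywhere. -/
theorem ae_density_mul_swap_eq_one {μ : Measure (X × X)} [IsFiniteMeasure μ]
    {ρ : X × X → ℝ≥0∞} (hρ : Measurable ρ)
    (h : μ.withDensity ρ = μ.map Prod.swap) :
    ∀ᵐ z ∂μ, ρ z * ρ z.swap = 1 := by
  have key : μ.withDensity (fun z => ρ z * ρ z.swap) = μ.withDensity 1 := by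
    ext A hA
    have hi : Measurable (A.indicator (fun z : X × X => ρ z.swap)) :=
      (hρ.comp measurable_swap).indicator hA
    rw [withDensity_one, withDensity_apply _ hA, ← lintegral_indicator hA]
    calc ∫⁻ z, A.indicator (fun z => ρ z * ρ z.swap) z ∂μ
        = ∫⁻ z, ρ z * A.indicator (fun z => ρ z.swap) z ∂μ := by
          congr 1 with z
          by_cases hz : z ∈ A <;> simp [hz]
      _ = ∫⁻ z, A.indicator (fun z => ρ z.swap) z ∂(μ.withDensity ρ) :=
          (lintegral_withDensity_eq_lintegral_mul μ hρ hi).symm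
      _ = ∫⁻ z, A.indicator (fun z => ρ z.swap) z.swap ∂μ := by
          rw [h, lintegral_map hi measurable_swap]
      _ = ∫⁻ z, ρ z * (Prod.swap ⁻¹' A).indicator 1 z ∂μ := by
          congr 1 with z
          by_cases hz : z.swap ∈ A <;> simp [hz]
      _ = ∫⁻ z, (Prod.swap ⁻¹' A).indicator 1 z ∂(μ.withDensity ρ) :=
          (lintegral_withDensity_eq_lintegral_mul μ hρ
            (measurable_one.indicator (measurable_swap hA))).symm
      _ = μ A := by
          rw [lintegral_indicator_one (measurable_swap hA), h,
            Measure.map_apply measurable_swap (measurable_swap hA), ← Set.preimage_comp]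
          simp
  have := (withDensity_eq_iff_of_sigmaFinite
    (hρ.mul (hρ.comp measurable_swap)).aemeasurable aemeasurable_const).1 key
  filter_upwards [this] with z hz using hz

/-- Detailed balance of the Metropolis–Hastings acceptance rate. -/
theorem lintegral_min_one_mul_swap {μ : Measure (X × X)} [IsFiniteMeasure μ]
    {ρ : X × X → ℝ≥0∞} (hρ : Measurable ρ) (h : μ.withDensity ρ = μ.map Prod.swap)
    {g : X × X → ℝ≥0∞} (hg : Measurable g) :
    ∫⁻ z, min 1 (ρ z) * g z.swap ∂μ = ∫⁻ z, min 1 (ρ z) * g z ∂μ := by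
  have hm : Measurable fun z : X × X => min 1 (ρ z.swap) * g z :=
    (measurable_const.min (hρ.comp measurable_swap)).mul hg
  calc ∫⁻ z, min 1 (ρ z) * g z.swap ∂μ
      = ∫⁻ z, min 1 (ρ z.swap) * g z ∂(μ.map Prod.swap) := by
        rw [lintegral_map hm measurable_swap]; simp
    _ = ∫⁻ z, ρ z * (min 1 (ρ z.swap) * g z) ∂μ := by
        rw [← h]; exact lintegral_withDensity_eq_lintegral_mul μ hρ hm
    _ = ∫⁻ z, min 1 (ρ z) * g z ∂μ := by
        refine lintegral_congr_ae ?_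
        filter_upwards [ae_density_mul_swap_eq_one hρ h] with z hz
        rw [← mul_assoc, mul_min, hz, mul_one, min_comm]

/-- The law of `((x, w), (y, u))` with `x ∼ π`, `w ∼ η x`, `y ∼ q x` and `u ∼ κ y`. -/
noncomputable def pairMeasure (π : Measure X) (η : Kernel X W) (q : Kernel X X)
    (κ : Kernel X W) : Measure ((X × W) × (X × W)) :=
  (π.compProd η).compProd ((q.compProd (Kernel.prodMkLeft X κ)).comap Prod.fst measurable_fst)

section pairMeasure

variable {π : Measure X} [IsProbabilityMeasure π] {η : Kernel X W} [IsMarkovKernel η]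
  {q : Kernel X X} [IsMarkovKernel q] {κ : Kernel X W} [IsMarkovKernel κ]

theorem lintegral_pairMeasure {H : (X × W) × (X × W) → ℝ≥0∞} (hH : Measurable H) :
    ∫⁻ z, H z ∂(pairMeasure π η q κ) =
      ∫⁻ x, ∫⁻ w, ∫⁻ y, ∫⁻ u, H ((x, w), (y, u)) ∂(κ y) ∂(q x) ∂(η x) ∂π := by
  rw [pairMeasure, Measure.lintegral_compProd hH, Measure.lintegral_compProd]
  · congr 1 with x
    congr 1 with w
    rw [Kernel.lintegral_comap, Kernel.lintegral_compProd _ _ _ (by fun_prop)]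
    simp
  · exact Measurable.lintegral_kernel_prod_right' hH

theorem lintegral_pairMeasure_fst {h : X × W → ℝ≥0∞} (hh : Measurable h) :
    ∫⁻ z, h z.1 ∂(pairMeasure π η q κ) = ∫⁻ x, ∫⁻ w, h (x, w) ∂(η x) ∂π := by
  rw [lintegral_pairMeasure (H := fun z => h z.1) (by fun_prop)]
  simp

/-- Proposals may be drawn before the auxiliary variables. -/
theorem lintegral_pairMeasure_eq_lintegral_compProd {a : X × X → ℝ≥0∞} (ha : Measurable a)
    {H : (X × W) × (X × W) → ℝ≥0∞} (hH : Measurable H) :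
    ∫⁻ z, a (z.1.1, z.2.1) * H z ∂(pairMeasure π η q κ) =
      ∫⁻ z, a z * ∫⁻ w, ∫⁻ u, H ((z.1, w), (z.2, u)) ∂(κ z.2) ∂(η z.1) ∂(π.compProd q) := by
  have hu : Measurable fun t : (X × X) × W =>
      ∫⁻ u, H ((t.1.1, t.2), (t.1.2, u)) ∂(κ t.1.2) :=
    Measurable.lintegral_kernel_prod_right'
      (κ := κ.comap (fun t : (X × X) × W => t.1.2) (by fun_prop))
      (f := fun t : ((X × X) × W) × W => H ((t.1.1.1, t.1.2), (t.1.1.2, t.2))) (by fun_prop)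
  have hw : Measurable fun t : X × X =>
      ∫⁻ w, ∫⁻ u, H ((t.1, w), (t.2, u)) ∂(κ t.2) ∂(η t.1) :=
    Measurable.lintegral_kernel_prod_right'
      (κ := η.comap (fun t : X × X => t.1) (by fun_prop)) hu
  rw [lintegral_pairMeasure (by fun_prop),
    Measure.lintegral_compProd (f := fun z => a z * ∫⁻ w, ∫⁻ u, H ((z.1, w), (z.2, u)) ∂(κ z.2)
      ∂(η z.1)) (ha.mul hw)]
  congr 1 with x
  calc ∫⁻ w, ∫⁻ y, ∫⁻ u, a (x, y) * H ((x, w), (y, u)) ∂(κ y) ∂(q x) ∂(η x)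
      = ∫⁻ w, ∫⁻ y, a (x, y) * ∫⁻ u, H ((x, w), (y, u)) ∂(κ y) ∂(q x) ∂(η x) := by
        congr 1 with w
        congr 1 with y
        rw [lintegral_const_mul _ (by fun_prop)]
    _ = ∫⁻ y, ∫⁻ w, a (x, y) * ∫⁻ u, H ((x, w), (y, u)) ∂(κ y) ∂(η x) ∂(q x) := by
        refine lintegral_lintegral_swap (Measurable.aemeasurable ?_)
        exact (ha.comp (by fun_prop : Measurable fun t : W × X => (x, t.2))).mul
          (hu.comp (by fun_prop : Measurable fun t : W × X => ((x, t.2), t.1)))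
    _ = _ := by
        congr 1 with y
        exact lintegral_const_mul _
          (hu.comp (by fun_prop : Measurable fun w : W => ((x, y), w)))

/-- Reversibility of the Metropolis–Hastings chain embedded in the extended space. -/
theorem lintegral_pairMeasure_swap {ρ : X × X → ℝ≥0∞} (hρ : Measurable ρ)
    (h : (π.compProd q).withDensity ρ = (π.compProd q).map Prod.swap)
    {H : (X × W) × (X × W) → ℝ≥0∞} (hH : Measurable H) :
    ∫⁻ z, min 1 (ρ (z.1.1, z.2.1)) * H z.swap ∂(pairMeasure π η q η) =
      ∫⁻ z, min 1 (ρ (z.1.1, z.2.1)) * H z ∂(pairMeasure π η q η) := by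
  have ha : Measurable fun z => min 1 (ρ z) := measurable_const.min hρ
  have hu : Measurable fun t : (X × X) × W =>
      ∫⁻ u, H ((t.1.1, t.2), (t.1.2, u)) ∂(η t.1.2) :=
    Measurable.lintegral_kernel_prod_right'
      (κ := η.comap (fun t : (X × X) × W => t.1.2) (by fun_prop))
      (f := fun t : ((X × X) × W) × W => H ((t.1.1.1, t.1.2), (t.1.1.2, t.2))) (by fun_prop)
  have hw : Measurable fun t : X × X =>
      ∫⁻ w, ∫⁻ u, H ((t.1, w), (t.2, u)) ∂(η t.2) ∂(η t.1) :=
    Measurable.lintegral_kernel_prod_right'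
      (κ := η.comap (fun t : X × X => t.1) (by fun_prop)) hu
  rw [lintegral_pairMeasure_eq_lintegral_compProd (H := fun z => H z.swap) ha (by fun_prop),
    lintegral_pairMeasure_eq_lintegral_compProd ha hH, ← lintegral_min_one_mul_swap hρ h hw]
  congr 1 with z
  congr 1
  exact lintegral_lintegral_swap (by fun_prop)

end pairMeasure

/-- Replacing the law of the second auxiliary variable by one with a density. -/
theorem lintegral_pairMeasure_withDensity {π : Measure X} [IsProbabilityMeasure π]
    {η : Kernel X W} [IsMarkovKernel η] {q : Kernel X X} [IsMarkovKernel q]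
    {κ : Kernel X W} [IsMarkovKernel κ] {d : W → ℝ≥0∞} (hd : Measurable d)
    [IsMarkovKernel (κ.withDensity fun _ => d)]
    {H : (X × W) × (X × W) → ℝ≥0∞} (hH : Measurable H) :
    ∫⁻ z, H z ∂(pairMeasure π η q (κ.withDensity fun _ => d)) =
      ∫⁻ z, d z.2.2 * H z ∂(pairMeasure π η q κ) := by
  rw [lintegral_pairMeasure hH, lintegral_pairMeasure (by fun_prop)]
  congr 1 with x
  congr 1 with w
  congr 1 with y
  rw [Kernel.withDensity_apply _ (by fun_prop)]
  exact lintegral_withDensity_eq_lintegral_mul _ hd (by fun_prop)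

/-- Away from large weights, the embedded acceptance rate is controlled by the
pseudo-marginal one. -/
theorem mul_min_one_le {r s u w : ℝ} (hr : 0 ≤ r) (hu : 0 < u) (hus : u ≤ s)
    (hw : 0 < w) (hws : w ≤ s) : u * min 1 r ≤ s * min 1 (r * u / w) := by
  have hs : 0 ≤ s := hu.le.trans hus
  rw [mul_min_of_nonneg _ _ hu.le, mul_min_of_nonneg _ _ hs]
  refine min_le_min (by linarith) ?_
  rw [mul_div_assoc', le_div_iff₀ hw]
  nlinarith [mul_le_mul_of_nonneg_left hws (mul_nonneg hr hu.le)]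

/-- Hölder bound for the part of a symmetric Dirichlet form carried by a symmetric set. -/
theorem setLIntegral_sub_sq_le {Z : Type*} [MeasurableSpace Z] {M : Measure (Z × Z)}
    (hM : ∀ H : Z × Z → ℝ≥0∞, Measurable H → ∫⁻ z, H z.swap ∂M = ∫⁻ z, H z ∂M)
    {A : Set (Z × Z)} (hA : MeasurableSet A) (hAs : ∀ z, z.swap ∈ A ↔ z ∈ A)
    {f : Z → ℝ} (hf : Measurable f) {p q : ℝ} (hpq : p.HolderConjugate q) :
    ∫⁻ z in A, ENNReal.ofReal ((f z.2 - f z.1) ^ 2) ∂M ≤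
      4 * ((∫⁻ z, ENNReal.ofReal (|f z.1| ^ (2 * p)) ∂M) ^ (1 / p) * M A ^ (1 / q)) := by
  have h2 : ∫⁻ z in A, ENNReal.ofReal (f z.2 ^ 2) ∂M
      = ∫⁻ z in A, ENNReal.ofReal (f z.1 ^ 2) ∂M := by
    rw [← lintegral_indicator hA, ← lintegral_indicator hA,
      ← hM _ (Measurable.indicator (by fun_prop) hA)]
    congr 1 with z
    by_cases hz : z ∈ A
    · simp [Set.indicator_of_mem, hz, (hAs z).2 hz]
    · simp [Set.indicator_of_notMem, hz, mt (hAs z).1 hz]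
  have h1 : ∫⁻ z in A, ENNReal.ofReal (f z.1 ^ 2) ∂M ≤
      (∫⁻ z, ENNReal.ofReal (|f z.1| ^ (2 * p)) ∂M) ^ (1 / p) * M A ^ (1 / q) := by
    have := ENNReal.lintegral_mul_le_Lp_mul_Lq M hpq
      (f := fun z => ENNReal.ofReal (f z.1 ^ 2)) (g := A.indicator 1)
      (by fun_prop) (measurable_one.indicator hA).aemeasurable
    convert this using 1
    · rw [← lintegral_indicator hA]
      congr 1 with z
      by_cases hz : z ∈ A <;> simp [hz]
    · congr 2
      · congr 1 with z
        rw [ENNReal.ofReal_rpow_of_nonneg (sq_nonneg _) hpq.nonneg, ← sq_abs,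
          ← Real.rpow_natCast, ← Real.rpow_mul (abs_nonneg _)]
        norm_num
      · rw [← lintegral_indicator_one hA]
        congr 1 with z
        by_cases hz : z ∈ A <;> simp [hz, hpq.symm.pos]
  calc ∫⁻ z in A, ENNReal.ofReal ((f z.2 - f z.1) ^ 2) ∂M
      ≤ ∫⁻ z in A, (2 * ENNReal.ofReal (f z.2 ^ 2) + 2 * ENNReal.ofReal (f z.1 ^ 2)) ∂M := by
        refine lintegral_mono fun z => ?_
        rw [← ENNReal.ofReal_ofNat 2, ← ENNReal.ofReal_mul zero_le_two,
          ← ENNReal.ofReal_mul zero_le_two, ← ENNReal.ofReal_add (by positivity) (by positivity)]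
        exact ENNReal.ofReal_le_ofReal (by nlinarith [sq_nonneg (f z.2 + f z.1)])
    _ = 4 * ∫⁻ z in A, ENNReal.ofReal (f z.1 ^ 2) ∂M := by
        rw [lintegral_add_left (by fun_prop), lintegral_const_mul _ (by fun_prop),
          lintegral_const_mul _ (by fun_prop), h2, ← add_mul]
        norm_num
    _ ≤ _ := by gcongr

end PseudoMarginal

/-- Theorem (Dirichlet form comparison for pseudo-marginal chains): with the embedded marginal
kernel on the left and the pseudo-marginal kernel on the right,
`E(P̄,f) ≤ s·E(P̃,f) + Φ_p(f)·(∫ π̃_x(w ≥ s) π(dx))^{1/q}` with `Φ_p(f) = 4‖f‖_{2p}²`. -/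
theorem stmt18 {X : Type*} [MeasurableSpace X] [StandardBorelSpace X]
    (π : Measure X) [IsProbabilityMeasure π]
    (q : Kernel X X) [IsMarkovKernel q]
    (Q : Kernel X ℝ) [IsMarkovKernel Q]
    (hQsupp : ∀ x : X, Q x {w : ℝ | w ≤ 0} = 0)
    (hQmean : ∀ x : X, ∫⁻ w, ENNReal.ofReal w ∂(Q x) = 1)
    (ν : X → Measure ℝ)
    (hν : ν = fun x => (Q x).withDensity fun w => ENNReal.ofReal w)
    (r : X × X → ℝ) (hrm : Measurable r) (hr0 : ∀ z : X × X, 0 ≤ r z)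
    (hrev : (π.compProd q).withDensity (fun z => ENNReal.ofReal (r z)) =
      Measure.map Prod.swap (π.compProd q))
    (p q' : ℝ) (hp : 1 < p) (hq' : 1 ≤ q') (hpq : 1 / p + 1 / q' = 1)
    (f : X × ℝ → ℝ) (hf : Measurable f)
    (N : ℝ≥0∞)
    (hN : N = (∫⁻ x, ∫⁻ w, ENNReal.ofReal (|f (x, w)| ^ (2 * p)) ∂(ν x) ∂π) ^ (1 / (2 * p)))
    (hNfin : N ≠ ∞)
    (s : ℝ) (hs : 0 < s) :
    (1 / 2 : ℝ≥0∞) * ∫⁻ x, ∫⁻ w, ∫⁻ y, ∫⁻ u,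
        ENNReal.ofReal (min 1 (r (x, y)) * (f (y, u) - f (x, w)) ^ 2) ∂(ν y) ∂(q x) ∂(ν x) ∂π ≤
      ENNReal.ofReal s * ((1 / 2 : ℝ≥0∞) * ∫⁻ x, ∫⁻ w, ∫⁻ y, ∫⁻ u,
          ENNReal.ofReal (min 1 (r (x, y) * u / w) * (f (y, u) - f (x, w)) ^ 2)
            ∂(Q y) ∂(q x) ∂(ν x) ∂π) +
        4 * N ^ 2 * (2 * ∫⁻ x, ν x (Set.Ici s) ∂π) ^ (1 / q') := by
  subst hν
  set d : ℝ → ℝ≥0∞ := fun w => ENNReal.ofReal w with hd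
  have hdm : Measurable d := ENNReal.measurable_ofReal
  set η : Kernel X ℝ := Q.withDensity fun _ => d with hη
  have hηx : ∀ x, η x = (Q x).withDensity d := fun x =>
    Kernel.withDensity_apply Q (by fun_prop) x
  simp only [← hηx] at hN ⊢
  have : IsMarkovKernel η := ⟨fun x => ⟨by
    rw [hηx, withDensity_apply _ .univ, Measure.restrict_univ, hQmean]⟩⟩
  set a : X × X → ℝ≥0∞ := fun z => min 1 (ENNReal.ofReal (r z)) with ha
  have ham : Measurable a := by fun_prop
  have ha_eq : ∀ z, ENNReal.ofReal (min 1 (r z)) = a z := fun z => by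
    simp [ha, ENNReal.ofReal_min]
  set D : (X × ℝ) × (X × ℝ) → ℝ≥0∞ := fun z => ENNReal.ofReal ((f z.2 - f z.1) ^ 2) with hD
  have hDm : Measurable D := by fun_prop
  set G : (X × ℝ) × (X × ℝ) → ℝ≥0∞ := fun z =>
    ENNReal.ofReal (min 1 (r (z.1.1, z.2.1) * z.2.2 / z.1.2) * (f z.2 - f z.1) ^ 2) with hG
  have hGm : Measurable G := by fun_prop
  set A : Set ((X × ℝ) × (X × ℝ)) := {z | s ≤ z.1.2 ∨ s ≤ z.2.2} with hA
  have hA1 : MeasurableSet {z : (X × ℝ) × (X × ℝ) | s ≤ z.1.2} :=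
    measurableSet_le (by fun_prop) (by fun_prop)
  have hA2 : MeasurableSet {z : (X × ℝ) × (X × ℝ) | s ≤ z.2.2} :=
    measurableSet_le (by fun_prop) (by fun_prop)
  have hAm : MeasurableSet A := hA1.union hA2
  set P := PseudoMarginal.pairMeasure π η q η with hP
  set b : (X × ℝ) × (X × ℝ) → ℝ≥0∞ := fun z => a (z.1.1, z.2.1) with hb
  have hbm : Measurable b := by fun_prop
  set M := P.withDensity b with hMdef
  have hM : ∀ H, Measurable H → ∫⁻ z, H z ∂M = ∫⁻ z, b z * H z ∂P := fun H hH =>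
    lintegral_withDensity_eq_lintegral_mul P hbm hH
  have hMsymm : ∀ H, Measurable H → ∫⁻ z, H z.swap ∂M = ∫⁻ z, H z ∂M := fun H hH => by
    rw [hM _ hH, hM (fun z => H z.swap) (by fun_prop)]
    exact PseudoMarginal.lintegral_pairMeasure_swap hrm.ennreal_ofReal hrev hH
  have hMfst : ∀ h : X × ℝ → ℝ≥0∞, Measurable h →
      ∫⁻ z, h z.1 ∂M ≤ ∫⁻ x, ∫⁻ w, h (x, w) ∂(η x) ∂π := fun h hh => by
    rw [hM (fun z => h z.1) (by fun_prop),
      ← PseudoMarginal.lintegral_pairMeasure_fst (q := q) (κ := η) hh]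
    exact lintegral_mono fun z => mul_le_of_le_one_left' (min_le_left _ _)
  have hlhs : ∫⁻ x, ∫⁻ w, ∫⁻ y, ∫⁻ u,
      ENNReal.ofReal (min 1 (r (x, y)) * (f (y, u) - f (x, w)) ^ 2)
        ∂(η y) ∂(q x) ∂(η x) ∂π = ∫⁻ z, D z ∂M := by
    rw [hM _ hDm, hP, PseudoMarginal.lintegral_pairMeasure (by fun_prop)]
    simp only [hb, hD, ← ha_eq,
      ENNReal.ofReal_mul (le_min zero_le_one (hr0 _) : 0 ≤ min 1 (r _))]
  have hrhs : ∫⁻ x, ∫⁻ w, ∫⁻ y, ∫⁻ u,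
      ENNReal.ofReal (min 1 (r (x, y) * u / w) * (f (y, u) - f (x, w)) ^ 2)
        ∂(Q y) ∂(q x) ∂(η x) ∂π = ∫⁻ z, G z ∂(PseudoMarginal.pairMeasure π η q Q) := by
    rw [PseudoMarginal.lintegral_pairMeasure hGm]
  have hQpos : ∀ x, ∀ᵐ w ∂(Q x), 0 < w := fun x => by
    rw [ae_iff]; simpa using hQsupp x
  have hηpos : ∀ x, ∀ᵐ w ∂(η x), 0 < w := fun x => by
    rw [hηx]; exact (withDensity_absolutelyContinuous _ _).ae_le (hQpos x)
  have hsplit : ∫⁻ z, D z ∂M ≤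
      ENNReal.ofReal s * ∫⁻ z, G z ∂(PseudoMarginal.pairMeasure π η q Q) +
        ∫⁻ z in A, D z ∂M := by
    have hAD : Measurable (A.indicator D) := hDm.indicator hAm
    rw [← lintegral_indicator hAm, hM _ hDm, hM _ hAD, hP, hη,
      PseudoMarginal.lintegral_pairMeasure_withDensity hdm (by fun_prop),
      PseudoMarginal.lintegral_pairMeasure_withDensity hdm (by fun_prop), ← hη,
      ← lintegral_const_mul _ hGm, ← lintegral_add_left (by fun_prop),
      PseudoMarginal.lintegral_pairMeasure (by fun_prop),
      PseudoMarginal.lintegral_pairMeasure (by fun_prop)]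
    refine lintegral_mono fun x => lintegral_mono_ae ?_
    filter_upwards [hηpos x] with w hw
    refine lintegral_mono fun y => lintegral_mono_ae ?_
    filter_upwards [hQpos y] with u hu
    by_cases hz : ((x, w), (y, u)) ∈ A
    · rw [Set.indicator_of_mem hz]
      exact le_add_self
    · refine le_add_right ?_
      obtain ⟨hws, hus⟩ : w < s ∧ u < s := by simpa [hA] using hz
      have hmin : 0 ≤ min 1 (r (x, y)) := le_min zero_le_one (hr0 _)
      simp only [hd, hb, hD, hG, ← ha_eq]
      rw [← ENNReal.ofReal_mul hmin, ← ENNReal.ofReal_mul hu.le, ← ENNReal.ofReal_mul hs.le,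
        ← mul_assoc, ← mul_assoc]
      exact ENNReal.ofReal_le_ofReal (mul_le_mul_of_nonneg_right
        (PseudoMarginal.mul_min_one_le (hr0 _) hu hus.le hw hws.le) (sq_nonneg _))
  have hMA : M A ≤ 2 * ∫⁻ x, η x (Set.Ici s) ∂π := by
    have h1 : M {z | s ≤ z.1.2} ≤ ∫⁻ x, η x (Set.Ici s) ∂π := by
      have hS : MeasurableSet {z : X × ℝ | s ≤ z.2} :=
        measurableSet_le (by fun_prop) (by fun_prop)
      refine le_trans (le_of_eq ?_) ((hMfst _ (measurable_one.indicator hS)).trans_eq ?_)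
      · rw [← lintegral_indicator_one hA1]
        rfl
      · congr 1 with x
        rw [← lintegral_indicator_one measurableSet_Ici]
        rfl
    have h2 : M {z | s ≤ z.2.2} = M {z | s ≤ z.1.2} := by
      rw [← lintegral_indicator_one hA1, ← lintegral_indicator_one hA2,
        ← hMsymm _ (measurable_one.indicator hA1)]
      rfl
    calc M A ≤ M {z | s ≤ z.1.2} + M {z | s ≤ z.2.2} := measure_union_le _ _
      _ ≤ _ := by rw [h2, two_mul]; gcongr
  have hconj : p.HolderConjugate q' := by
    rw [Real.holderConjugate_iff]
    exact ⟨hp, by simpa using hpq⟩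
  have hN2 : (∫⁻ x, ∫⁻ w, ENNReal.ofReal (|f (x, w)| ^ (2 * p)) ∂(η x) ∂π) ^ (1 / p) = N ^ 2 := by
    rw [hN, ← ENNReal.rpow_natCast, ← ENNReal.rpow_mul]
    congr 1
    push_cast
    field_simp
  have hp0 : 0 ≤ 1 / p := by positivity
  have hq0 : 0 ≤ 1 / q' := by positivity
  have hholder : ∫⁻ z in A, D z ∂M ≤
      4 * (N ^ 2 * (2 * ∫⁻ x, η x (Set.Ici s) ∂π) ^ (1 / q')) := by
    refine (PseudoMarginal.setLIntegral_sub_sq_le hMsymm hAm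
      (fun z => by simp [hA, or_comm]) hf hconj).trans ?_
    rw [← hN2]
    gcongr
    exact hMfst (fun z => ENNReal.ofReal (|f z| ^ (2 * p))) (by fun_prop)
  rw [hlhs, hrhs, mul_left_comm]
  calc (1 / 2 : ℝ≥0∞) * ∫⁻ z, D z ∂M
      ≤ 1 / 2 * (ENNReal.ofReal s * ∫⁻ z, G z ∂(PseudoMarginal.pairMeasure π η q Q) +
          ∫⁻ z in A, D z ∂M) := by gcongr
    _ ≤ _ := by
      rw [mul_add, mul_assoc 4]
      exact add_le_add le_rfl ((mul_le_of_le_one_left' (by simp)).trans hholder)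
end
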